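/- arXiv:1806.10304 — 12 statements merged into one kernel-verified Lean document; each statement's English description precedes it below -/
import Mathlib

section
/- Let p₁, q₁, r₁, p₂, q₂, r₂, a, b, c be real numbers with c ≠ 0. Let (P_n)_{n∈ℤ} = 𝒫(x)(p₁,q₁,r₁;a,b,c), (Q_n)_{n∈ℤ} = 𝒫(x)(p₂,q₂,r₂;a,b,c), and (U_n)_{n∈ℤ} = 𝒫(x)(0,0,1;a,b,c) be the associated sequences of real polynomials. Then for all integers s, i, j: P_{s+i}·Q_{s+j} − P_s·Q_{s+i+j} = (−c)^s·(P₁·Q_j − P₀·Q_{j+1})·U_i, where (−c)^s denotes the integer power (well-defined since c ≠ 0). -/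
open Polynomial Finset

/-- A two-sided solution of a second order linear recurrence with nonzero last coefficient
vanishes if it vanishes at `0` and `1`. -/
theorem eq_zero_of_second_order_rec {R : Type*} [CommRing R] [NoZeroDivisors R] {t c : R}
    (hc : c ≠ 0) {F : ℤ → R} (hF : ∀ n, F (n + 2) = t * F (n + 1) + c * F n)
    (h0 : F 0 = 0) (h1 : F 1 = 0) (n : ℤ) : F n = 0 := by
  suffices h : F n = 0 ∧ F (n + 1) = 0 from h.1
  induction n using Int.induction_on with
  | zero => simp [h0, h1]
  | succ k ih =>
    refine ⟨ih.2, ?_⟩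
    rw [show (k : ℤ) + 1 + 1 = k + 2 by ring, hF, ih.1, ih.2]
    ring
  | pred k ih =>
    have h := hF (-(k : ℤ) - 1)
    rw [show -(k : ℤ) - 1 + 2 = -k + 1 by ring, sub_add_cancel, ih.1, ih.2] at h
    rw [sub_add_cancel]
    refine ⟨(mul_eq_zero.mp ?_).resolve_left hc, ih.1⟩
    linear_combination -h

/-- The Casoratian of `P` and a shift of `Q`, for two solutions of the same second order
recurrence, is multiplied by `-c` when the index grows by one. -/
theorem casoratian_succ {R : Type*} [CommRing R] {t c : R} {P Q : ℤ → R}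
    (hP : ∀ n, P (n + 2) = t * P (n + 1) + c * P n)
    (hQ : ∀ n, Q (n + 2) = t * Q (n + 1) + c * Q n) (j s : ℤ) :
    P (s + 1 + 1) * Q (s + 1 + j) - P (s + 1) * Q (s + 1 + 1 + j)
      = -c * (P (s + 1) * Q (s + j) - P s * Q (s + 1 + j)) := by
  have h1 := hP s
  have h2 := hQ (s + j)
  rw [show s + 2 = s + 1 + 1 by ring] at h1
  rw [show s + j + 2 = s + 1 + 1 + j by ring, show s + j + 1 = s + 1 + j by ring] at h2
  rw [h1, h2]
  ring

theorem casoratian_eq {K : Type*} [Field K] {t : K[X]} {c : K} (hc : c ≠ 0) {P Q : ℤ → K[X]}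
    (hP : ∀ n, P (n + 2) = t * P (n + 1) + C c * P n)
    (hQ : ∀ n, Q (n + 2) = t * Q (n + 1) + C c * Q n) (j s : ℤ) :
    P (s + 1) * Q (s + j) - P s * Q (s + 1 + j)
      = C ((-c) ^ s) * (P 1 * Q j - P 0 * Q (j + 1)) := by
  have hc' : -c ≠ 0 := neg_ne_zero.mpr hc
  induction s using Int.induction_on with
  | zero => simp [add_comm]
  | succ k ih =>
    rw [casoratian_succ hP hQ, ih, zpow_add_one₀ hc', C_mul, C_neg]
    ring
  | pred k ih =>
    have h := casoratian_succ hP hQ j (-(k : ℤ) - 1)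
    have hz : (-c) ^ (-(k : ℤ)) = (-c) ^ (-(k : ℤ) - 1) * -c := by
      rw [← zpow_add_one₀ hc', sub_add_cancel]
    rw [sub_add_cancel, ih, hz, C_mul, C_neg] at h
    rw [sub_add_cancel]
    refine mul_left_cancel₀ (neg_ne_zero.mpr (C_ne_zero.mpr hc)) ?_
    linear_combination -h

/-- **Theorem 1.** For sequences of real polynomials `P = 𝒫(x)(p₁,q₁,r₁;a,b,c)`,
`Q = 𝒫(x)(p₂,q₂,r₂;a,b,c)` and `U = 𝒫(x)(0,0,1;a,b,c)` (with `c ≠ 0`), one has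
`P_{s+i}·Q_{s+j} − P_s·Q_{s+i+j} = (−c)^s·(P₁·Q_j − P₀·Q_{j+1})·U_i` for all integers `s, i, j`. -/
theorem det_identity_generalized_catalan
    (p₁ q₁ r₁ p₂ q₂ r₂ a b c : ℝ) (hc : c ≠ 0)
    (P Q U : ℤ → Polynomial ℝ)
    (hP0 : P 0 = Polynomial.C p₁) (hP1 : P 1 = Polynomial.C q₁ * X + Polynomial.C r₁)
    (hPrec : ∀ n : ℤ, P (n + 2) = (Polynomial.C a * X + Polynomial.C b) * P (n + 1)
      + Polynomial.C c * P n)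
    (hQ0 : Q 0 = Polynomial.C p₂) (hQ1 : Q 1 = Polynomial.C q₂ * X + Polynomial.C r₂)
    (hQrec : ∀ n : ℤ, Q (n + 2) = (Polynomial.C a * X + Polynomial.C b) * Q (n + 1)
      + Polynomial.C c * Q n)
    (hU0 : U 0 = 0) (hU1 : U 1 = 1)
    (hUrec : ∀ n : ℤ, U (n + 2) = (Polynomial.C a * X + Polynomial.C b) * U (n + 1)
      + Polynomial.C c * U n)
    (s i j : ℤ) :
    P (s + i) * Q (s + j) - P s * Q (s + i + j)
      = Polynomial.C ((-c) ^ s) * (P 1 * Q j - P 0 * Q (j + 1)) * U i := by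
  have hW := casoratian_eq hc hPrec hQrec j s
  rw [← sub_eq_zero]
  refine eq_zero_of_second_order_rec (t := C a * X + C b) (c := C c) (C_ne_zero.mpr hc)
    (F := fun i => P (s + i) * Q (s + j) - P s * Q (s + i + j)
      - C ((-c) ^ s) * (P 1 * Q j - P 0 * Q (j + 1)) * U i) (fun n => ?_) ?_ ?_ i
  · have h1 := hPrec (s + n)
    have h2 := hQrec (s + n + j)
    rw [show s + n + j + 2 = s + (n + 2) + j by ring,
      show s + n + j + 1 = s + (n + 1) + j by ring] at h2
    rw [add_assoc, add_assoc] at h1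
    simp only [h1, h2, hUrec n]
    ring
  · simp [hU0]
  · simp only [hU1, hW]
    ring
end

section
/- Let p, q, r, a, b, c be real numbers with c ≠ 0. Let (P_n)_{n∈ℤ} = 𝒫(x)(p,q,r;a,b,c) and (U_n)_{n∈ℤ} = 𝒫(x)(0,0,1;a,b,c). Then for every integer j: P_j·P₁ − P₀·P_{j+1} = Δ_𝒫 · U_j, where Δ_𝒫 is the discriminant of 𝒫(x)(p,q,r;a,b,c). -/
open Polynomial Finset

/-- A two-sided solution of a second-order linear recurrence with nonzero trailing coefficient
that vanishes at `0` and `1` vanishes identically. -/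
theorem eq_zero_of_linear_recurrence {R : Type*} [CommRing R] [NoZeroDivisors R]
    {A B : R} (hB : B ≠ 0) {W : ℤ → R} (hW : ∀ n : ℤ, W (n + 2) = A * W (n + 1) + B * W n)
    (h0 : W 0 = 0) (h1 : W 1 = 0) (n : ℤ) : W n = 0 := by
  suffices h : W n = 0 ∧ W (n + 1) = 0 from h.1
  induction n with
  | zero => exact ⟨h0, by simpa using h1⟩
  | succ k ih =>
    refine ⟨ih.2, ?_⟩
    rw [add_assoc, one_add_one_eq_two, hW, ih.1, ih.2, mul_zero, mul_zero, add_zero]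
  | pred k ih =>
    have h := hW (-(k : ℤ) - 1)
    rw [show -(k : ℤ) - 1 + 2 = -k + 1 by ring, sub_add_cancel, ih.1, ih.2, mul_zero,
      zero_add] at h
    exact ⟨(mul_eq_zero.mp h.symm).resolve_left hB, by rw [sub_add_cancel, ih.1]⟩

/-- **Corollary 1, identity (8).** For sequences of real polynomials
`P = 𝒫(x)(p,q,r;a,b,c)` and `U = 𝒫(x)(0,0,1;a,b,c)` (with `c ≠ 0`),
`P_j·P₁ − P₀·P_{j+1} = Δ_𝒫 · U_j` for every integer `j`, where
`Δ_𝒫 = (q² − apq)x² + (2qr − apr − bpq)x + (r² − bpr − cp²)`. -/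
theorem catalan_discriminant_identity
    (p q r a b c : ℝ) (hc : c ≠ 0)
    (P U : ℤ → Polynomial ℝ)
    (hP0 : P 0 = Polynomial.C p) (hP1 : P 1 = Polynomial.C q * X + Polynomial.C r)
    (hPrec : ∀ n : ℤ, P (n + 2) = (Polynomial.C a * X + Polynomial.C b) * P (n + 1)
      + Polynomial.C c * P n)
    (hU0 : U 0 = 0) (hU1 : U 1 = 1)
    (hUrec : ∀ n : ℤ, U (n + 2) = (Polynomial.C a * X + Polynomial.C b) * U (n + 1)
      + Polynomial.C c * U n)
    (j : ℤ) :
    P j * P 1 - P 0 * P (j + 1)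
      = (Polynomial.C (q ^ 2 - a * p * q) * X ^ 2
          + Polynomial.C (2 * q * r - a * p * r - b * p * q) * X
          + Polynomial.C (r ^ 2 - b * p * r - c * p ^ 2)) * U j := by
  refine sub_eq_zero.mp (eq_zero_of_linear_recurrence
    (A := Polynomial.C a * X + Polynomial.C b) (Polynomial.C_ne_zero.mpr hc)
    (W := fun n : ℤ => P n * P 1 - P 0 * P (n + 1)
      - (Polynomial.C (q ^ 2 - a * p * q) * X ^ 2
          + Polynomial.C (2 * q * r - a * p * r - b * p * q) * X
          + Polynomial.C (r ^ 2 - b * p * r - c * p ^ 2)) * U n) (fun n => ?_) ?_ ?_ j)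
  · simp only [add_right_comm n 2 1, hPrec (n + 1), add_assoc n 1 1, one_add_one_eq_two,
      hPrec n, hUrec n]
    ring
  · simp only [hU0, zero_add]
    ring
  · have h2 := hPrec 0
    simp only [zero_add] at h2
    simp only [one_add_one_eq_two, h2, hP0, hP1, hU1, map_sub, map_mul, map_pow, map_ofNat]
    ring
end

section
/- Let p, q, r, a, b, c be real numbers with c ≠ 0. Let (P_n)_{n∈ℤ} = 𝒫(x)(p,q,r;a,b,c) and (U_n)_{n∈ℤ} = 𝒫(x)(0,0,1;a,b,c). Then for all integers s, i, j: P_{s+i}·P_{s+j} − P_s·P_{s+i+j} = (−c)^s · Δ_𝒫 · U_i · U_j, where Δ_𝒫 is the discriminant of 𝒫(x)(p,q,r;a,b,c) and (−c)^s is the integer power (well-defined since c ≠ 0). -/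
open Polynomial Finset

/-- A two-sided second-order linear recurrence with unit last coefficient is determined by its
values at `0` and `1`. -/
theorem eq_of_second_order_recurrence {R : Type*} [CommRing R] (t : R) (d : Rˣ) {F G : ℤ → R}
    (hF : ∀ n, F (n + 2) = t * F (n + 1) + d * F n)
    (hG : ∀ n, G (n + 2) = t * G (n + 1) + d * G n)
    (h0 : F 0 = G 0) (h1 : F 1 = G 1) (n : ℤ) : F n = G n := by
  suffices h : F n = G n ∧ F (n + 1) = G (n + 1) from h.1
  induction n with
  | zero => exact ⟨h0, by simpa using h1⟩
  | succ n ih =>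
    refine ⟨ih.2, ?_⟩
    rw [add_assoc, one_add_one_eq_two, hF, hG, ih.1, ih.2]
  | pred n ih =>
    rw [sub_add_cancel]
    refine ⟨d.isUnit.mul_left_cancel ?_, ih.1⟩
    have hF' := hF (-n - 1)
    have hG' := hG (-n - 1)
    rw [show (-n - 1 + 2 : ℤ) = -n + 1 by ring, sub_add_cancel] at hF' hG'
    linear_combination hG' - hF' + ih.2 - t * ih.1

/-- A two-sided geometric sequence with unit ratio. -/
theorem eq_zpow_mul_of_succ_eq_mul {R : Type*} [CommRing R] (e : Rˣ) {W : ℤ → R}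
    (hW : ∀ n, W (n + 1) = e * W n) (n : ℤ) : W n = ↑(e ^ n) * W 0 := by
  induction n with
  | zero => simp
  | succ n ih => rw [hW, ih, zpow_add_one, Units.val_mul]; ring
  | pred n ih =>
    apply e.isUnit.mul_left_cancel
    rw [← hW, sub_add_cancel, ih, ← mul_assoc, ← Units.val_mul, ← zpow_one_add, add_sub_cancel]

/-- The Catalan-type identity for second-order linear recurrences over a commutative ring. -/
theorem catalan_identity_of_second_order_recurrence {R : Type*} [CommRing R] (t : R) (d : Rˣ)
    {P U : ℤ → R} (hP : ∀ n, P (n + 2) = t * P (n + 1) + d * P n)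
    (hU : ∀ n, U (n + 2) = t * U (n + 1) + d * U n) (hU0 : U 0 = 0) (hU1 : U 1 = 1)
    (s i j : ℤ) :
    P (s + i) * P (s + j) - P s * P (s + i + j)
      = ↑((-d) ^ s) * (P 1 ^ 2 - t * P 0 * P 1 - d * P 0 ^ 2) * (U i * U j) := by
  have hW : P (s + 1) ^ 2 - P s * P (s + 2)
      = ↑((-d) ^ s) * (P 1 ^ 2 - t * P 0 * P 1 - d * P 0 ^ 2) := by
    have hgeom := eq_zpow_mul_of_succ_eq_mul (-d) (W := fun n => P (n + 1) ^ 2 - P n * P (n + 2))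
      (fun n => by
        have h := hP (n + 1)
        rw [show n + 1 + 2 = n + 3 by ring, show n + 1 + 1 = n + 2 by ring] at h
        simp only [show n + 1 + 2 = n + 3 by ring, show n + 1 + 1 = n + 2 by ring, Units.val_neg]
        linear_combination P (n + 2) * hP n - P (n + 1) * h) s
    have h0 := hP 0
    simp only [zero_add] at hgeom h0
    rw [hgeom, h0]
    ring
  have hrec (m n : ℤ) : P (m + (n + 2)) = t * P (m + (n + 1)) + d * P (m + n) := by
    simpa only [add_assoc] using hP (m + n)
  have hj : P (s + 1) * P (s + j) - P s * P (s + 1 + j)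
      = (P (s + 1) ^ 2 - P s * P (s + 2)) * U j := by
    refine eq_of_second_order_recurrence t d
      (F := fun j => P (s + 1) * P (s + j) - P s * P (s + 1 + j))
      (G := fun j => (P (s + 1) ^ 2 - P s * P (s + 2)) * U j) (fun n => ?_) (fun n => ?_) ?_ ?_ j
    · simp only [hrec]; ring
    · simp only [hU]; ring
    · simp only [add_zero, hU0]; ring
    · simp only [add_assoc, one_add_one_eq_two, hU1]; ring
  rw [← hW, mul_comm (U i), ← mul_assoc, ← hj]
  refine eq_of_second_order_recurrence t d
    (F := fun i => P (s + i) * P (s + j) - P s * P (s + i + j))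
    (G := fun i => (P (s + 1) * P (s + j) - P s * P (s + 1 + j)) * U i)
    (fun n => ?_) (fun n => ?_) ?_ ?_ i
  · simp only [add_right_comm s _ j, hrec]; ring
  · simp only [hU]; ring
  · simp only [add_zero, hU0]; ring
  · simp only [hU1, mul_one]

/-- **Corollary 1, identity (9).** For sequences of real polynomials
`P = 𝒫(x)(p,q,r;a,b,c)` and `U = 𝒫(x)(0,0,1;a,b,c)` (with `c ≠ 0`),
`P_{s+i}·P_{s+j} − P_s·P_{s+i+j} = (−c)^s · Δ_𝒫 · U_i · U_j` for all integers `s, i, j`. -/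
theorem catalan_discriminant_identity_general
    (p q r a b c : ℝ) (hc : c ≠ 0)
    (P U : ℤ → Polynomial ℝ)
    (hP0 : P 0 = Polynomial.C p) (hP1 : P 1 = Polynomial.C q * X + Polynomial.C r)
    (hPrec : ∀ n : ℤ, P (n + 2) = (Polynomial.C a * X + Polynomial.C b) * P (n + 1)
      + Polynomial.C c * P n)
    (hU0 : U 0 = 0) (hU1 : U 1 = 1)
    (hUrec : ∀ n : ℤ, U (n + 2) = (Polynomial.C a * X + Polynomial.C b) * U (n + 1)
      + Polynomial.C c * U n)
    (s i j : ℤ) :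
    P (s + i) * P (s + j) - P s * P (s + i + j)
      = Polynomial.C ((-c) ^ s)
          * ((Polynomial.C (q ^ 2 - a * p * q) * X ^ 2
              + Polynomial.C (2 * q * r - a * p * r - b * p * q) * X
              + Polynomial.C (r ^ 2 - b * p * r - c * p ^ 2)) * (U i * U j)) := by
  have hd : ((Units.map (C : ℝ →+* ℝ[X]).toMonoidHom (Units.mk0 c hc) : ℝ[X]ˣ) : ℝ[X]) = C c := rfl
  have hpow : (((-Units.map (C : ℝ →+* ℝ[X]).toMonoidHom (Units.mk0 c hc)) ^ s : ℝ[X]ˣ) : ℝ[X])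
      = C ((-c) ^ s) := by
    have hneg : -Units.map (C : ℝ →+* ℝ[X]).toMonoidHom (Units.mk0 c hc)
        = Units.map (C : ℝ →+* ℝ[X]).toMonoidHom (Units.mk0 (-c) (neg_ne_zero.mpr hc)) := by
      ext1
      simp
    rw [hneg, ← map_zpow, Units.coe_map, Units.val_zpow_eq_zpow_val]
    rfl
  rw [catalan_identity_of_second_order_recurrence (C a * X + C b)
    (Units.map (C : ℝ →+* ℝ[X]).toMonoidHom (Units.mk0 c hc)) hPrec hUrec hU0 hU1 s i j,
    hpow, hd, hP0, hP1]
  simp only [map_sub, map_mul, map_pow, map_ofNat]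
  ring
end

section
/- Let m ≥ 1 and let K be the field of rational functions ℝ(x). Let A_i, B_i, C_i, D_i ∈ K for 0 ≤ i ≤ m. Then the determinant of the (m+1)×(m+1) matrix whose (i,j) entry is (A_j·B_i + C_j·D_i)^m satisfies: det([(A_j B_i + C_j D_i)^m]_{0≤i,j≤m}) = ∏_{0≤i<j≤m} (B_i D_j − B_j D_i)(A_i C_j − A_j C_i) · ∏_{i=0}^{m} C(m,i), where C(m,i) is the binomial coefficient. -/
open Finset

/-- A product over pairs `i < j` in `Fin n`, as an iterated product over natural numbers. -/
theorem Fin.prod_prod_Ioi_eq_prod_range {M : Type*} [CommMonoid M] (n : ℕ) (f : ℕ → ℕ → M) :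
    ∏ i : Fin n, ∏ j ∈ Finset.Ioi i, f i j =
      ∏ j ∈ Finset.range n, ∏ i ∈ Finset.range j, f i j := by
  rw [Finset.prod_comm' (t' := Finset.univ) (s' := fun j => Finset.Iio j) (by simp),
    Finset.prod_range]
  refine Finset.prod_congr rfl fun j _ => ?_
  rw [← Nat.Iio_eq_range, ← Fin.map_valEmbedding_Iio, Finset.prod_map]
  rfl

/-- The binomial theorem as a factorization through projective Vandermonde matrices. -/
theorem Matrix.of_add_pow_eq_projVandermonde_mul {R : Type*} [CommRing R] (m : ℕ)
    (a b c d : Fin (m + 1) → R) :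
    Matrix.of (fun i j => (a j * b i + c j * d i) ^ m) =
      Matrix.projVandermonde b d * Matrix.diagonal (fun k : Fin (m + 1) => (m.choose k : R)) *
        (Matrix.projVandermonde a c).transpose := by
  ext i j
  rw [Matrix.mul_apply, Matrix.of_apply, add_pow, Finset.sum_range]
  refine Finset.sum_congr rfl fun k _ => ?_
  have hk : (k.rev : ℕ) = m - k := by rw [Fin.val_rev]; lia
  rw [Matrix.mul_diagonal, Matrix.transpose_apply, Matrix.projVandermonde_apply,
    Matrix.projVandermonde_apply, hk]
  ring

/-- **Lemma 1.** For elements `A_i, B_i, C_i, D_i` of `ℝ(x)`, the determinant of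
the `(m+1)×(m+1)` matrix with `(i,j)` entry `(A_j B_i + C_j D_i)^m` equals
`∏_{0≤i<j≤m} (B_i D_j − B_j D_i)(A_i C_j − A_j C_i) · ∏_{i=0}^m C(m,i)`. -/
theorem det_power_sum_identity (m : ℕ) (hm : 1 ≤ m) (A B C D : ℕ → RatFunc ℝ) :
    Matrix.det (Matrix.of fun i j : Fin (m + 1) =>
        (A j.1 * B i.1 + C j.1 * D i.1) ^ m)
      = (∏ j ∈ Finset.range (m + 1), ∏ i ∈ Finset.range j,
          ((B i * D j - B j * D i) * (A i * C j - A j * C i)))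
        * ∏ i ∈ Finset.range (m + 1), (Nat.choose m i : RatFunc ℝ) := by
  rw [Matrix.of_add_pow_eq_projVandermonde_mul m (fun j => A j) (fun i => B i) (fun j => C j)
      (fun i => D i), Matrix.det_mul, Matrix.det_mul, Matrix.det_transpose, Matrix.det_diagonal,
    Matrix.det_projVandermonde, Matrix.det_projVandermonde, ← Fin.prod_prod_Ioi_eq_prod_range,
    Finset.prod_range, mul_right_comm, ← Finset.prod_mul_distrib]
  congr 1
  refine Finset.prod_congr rfl fun i _ => ?_
  rw [← Finset.prod_mul_distrib]
  refine Finset.prod_congr rfl fun j _ => ?_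
  ring
end

section
/- Let s, k, n be any integers and m ≥ 1. Let p, q, r, a, b, c be real numbers with c ≠ 0. Let (P_n)_{n∈ℤ} = 𝒫(x)(p,q,r;a,b,c) and (U_n)_{n∈ℤ} = 𝒫(x)(0,0,1;a,b,c). Then the determinant of the (m+1)×(m+1) matrix with (i,j) entry P_{s+k(n+i+j)}^m equals (−1)^{(s+kn+1)·C(m+1,2)} · Δ_𝒫^{C(m+1,2)} · c^{(s+kn)·C(m+1,2) + 2k·C(m+1,3)} · ∏_{i=0}^{m} [ C(m,i) · U_{k(i+1)}^{2(m−i)} ], where Δ_𝒫 is the discriminant of 𝒫(x)(p,q,r;a,b,c), C(·,·) are binomial coefficients, and the powers of −1 and c with (possibly negative) integer exponents are interpreted as integer powers (well-defined since c ≠ 0); this is an identity in the field of rational functions ℝ(x). -/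
open Polynomial Finset

section LinearRecurrence

variable {F : Type*} [Field F] {e c : F} {P U f : ℤ → F}

/-- A solution of a second order recurrence that vanishes at `0` and `1` vanishes everywhere. -/
theorem eq_zero_of_recurrence (hc : c ≠ 0) (hf : ∀ n, f (n + 2) = e * f (n + 1) + c * f n)
    (h0 : f 0 = 0) (h1 : f 1 = 0) (n : ℤ) : f n = 0 := by
  suffices h : f n = 0 ∧ f (n + 1) = 0 from h.1
  induction n using Int.induction_on with
  | zero => simp [h0, h1]
  | succ i ih =>
    refine ⟨ih.2, ?_⟩
    rw [add_assoc, one_add_one_eq_two, hf, ih.1, ih.2]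
    ring
  | pred i ih =>
    have h := hf (-(i : ℤ) - 1)
    rw [show -(i : ℤ) - 1 + 2 = -i + 1 by ring, sub_add_cancel, ih.1, ih.2] at h
    rw [sub_add_cancel]
    refine ⟨?_, ih.1⟩
    simpa [hc] using h.symm

theorem recurrence_add (hc : c ≠ 0) (hP : ∀ n, P (n + 2) = e * P (n + 1) + c * P n)
    (hU : ∀ n, U (n + 2) = e * U (n + 1) + c * U n) (hU0 : U 0 = 0) (hU1 : U 1 = 1) (x y : ℤ) :
    P (x + y) = P (x + 1) * U y + P x * (c * U (y - 1)) := by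
  have hneg : c * U (-1) = 1 := by
    have h := hU (-1)
    norm_num [hU0, hU1] at h
    exact h.symm
  rw [← sub_eq_zero]
  refine eq_zero_of_recurrence (e := e) (c := c)
    (f := fun y => P (x + y) - (P (x + 1) * U y + P x * (c * U (y - 1)))) hc ?_ ?_ ?_ y
  · intro n
    have h := hU (n - 1)
    have h' := hP (x + n)
    rw [show n - 1 + 2 = n + 2 - 1 by ring, show n - 1 + 1 = n + 1 - 1 by ring] at h
    simp only [← add_assoc, h, hU n, h']
    ring
  · simp [hU0, hneg]
  · simp [hU0, hU1]

theorem recurrence_casoratian (hc : c ≠ 0) (hP : ∀ n, P (n + 2) = e * P (n + 1) + c * P n)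
    (x : ℤ) :
    P (x + 2) * P x - P (x + 1) ^ 2
      = -(P 1 ^ 2 - e * P 0 * P 1 - c * P 0 ^ 2) * (-c) ^ x := by
  have hc' : -c ≠ 0 := neg_ne_zero.mpr hc
  have step (n : ℤ) : P (n + 1 + 2) * P (n + 1) - P (n + 1 + 1) ^ 2
      = (P (n + 2) * P n - P (n + 1) ^ 2) * (-c) := by
    rw [hP (n + 1), show n + 1 + 1 = n + 2 by ring, hP n]
    ring
  induction x using Int.induction_on with
  | zero =>
    have h := hP 0
    simp only [zero_add] at h
    simp only [zero_add, h, zpow_zero]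
    ring
  | succ i ih => rw [step, ih, zpow_add_one₀ hc', mul_assoc]
  | pred i ih =>
    have h := step (-(i : ℤ) - 1)
    rw [sub_add_cancel, ih] at h
    apply mul_right_cancel₀ hc'
    rw [sub_add_cancel, ← h, mul_assoc _ (_ ^ _), ← zpow_add_one₀ hc', sub_add_cancel]

/-- The d'Ocagne identity. -/
theorem recurrence_dOcagne (hc : c ≠ 0) (hP : ∀ n, P (n + 2) = e * P (n + 1) + c * P n)
    (hU : ∀ n, U (n + 2) = e * U (n + 1) + c * U n) (hU0 : U 0 = 0) (hU1 : U 1 = 1) (x d : ℤ) :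
    P (x + d + 1) * P x - P (x + 1) * P (x + d)
      = -(P 1 ^ 2 - e * P 0 * P 1 - c * P 0 ^ 2) * (-c) ^ x * U d := by
  rw [← recurrence_casoratian hc hP, ← sub_eq_zero]
  refine eq_zero_of_recurrence (e := e) (c := c)
    (f := fun d => P (x + d + 1) * P x - P (x + 1) * P (x + d)
      - (P (x + 2) * P x - P (x + 1) ^ 2) * U d) hc ?_ ?_ ?_ d
  · intro n
    have h := hP (x + n)
    have h' := hP (x + n + 1)
    rw [show x + n + 1 + 2 = x + (n + 2) + 1 by ring,
      show x + n + 1 + 1 = x + (n + 1) + 1 by ring] at h'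
    rw [add_assoc x n 2, add_assoc x n 1] at h
    rw [add_assoc x n 1] at h'
    simp only [h, h', hU n, add_assoc x n 1]
    ring
  · simp [hU0, mul_comm]
  · rw [add_assoc, one_add_one_eq_two, hU1]
    ring

theorem prod_Ioi_zpow_mul (D : F) {z : F} (hz : z ≠ 0) (h : ℕ → F) (k : ℤ) (m : ℕ) (t : ℤ) :
    ∏ i : Fin (m + 1), ∏ j ∈ Ioi i, (D * z ^ (t + 2 * k * (i : ℕ)) * h ((j : ℕ) - i))
      = D ^ (m + 1).choose 2 * z ^ (t * (m + 1).choose 2 + 2 * k * (m + 1).choose 3)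
        * ∏ i ∈ range (m + 1), h (i + 1) ^ (m - i) := by
  induction m generalizing t with
  | zero => simp [Nat.choose_eq_zero_of_lt]
  | succ m ih =>
    have key : ∏ i ∈ range (m + 1 + 1), h (i + 1) ^ (m + 1 - i)
        = (∏ i ∈ range (m + 1), h (i + 1)) * ∏ i ∈ range (m + 1), h (i + 1) ^ (m - i) := by
      rw [prod_range_succ, Nat.sub_self, pow_zero, mul_one, ← prod_mul_distrib]
      refine prod_congr rfl fun i hi => ?_
      rw [Nat.succ_sub (mem_range_succ_iff.mp hi), pow_succ']
    have ih' := ih (t + 2 * k)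
    rw [Fin.prod_univ_succ, Fin.prod_Ioi_zero]
    simp only [Fin.prod_Ioi_succ, Fin.val_succ, Nat.add_sub_add_right, Fin.val_zero, Nat.sub_zero]
    rw [show (∏ i : Fin (m + 1), ∏ j ∈ Ioi i,
        (D * z ^ (t + 2 * k * ((i : ℕ) + 1 : ℕ)) * h ((j : ℕ) - i))) = _ from
      (prod_congr rfl fun i _ => prod_congr rfl fun j _ => by
        congr 3; push_cast; ring).trans ih']
    have hexp : z ^ (t * (m + 1 + 1).choose 2 + 2 * k * (m + 1 + 1).choose 3)
        = (z ^ t) ^ (m + 1)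
          * z ^ ((t + 2 * k) * (m + 1).choose 2 + 2 * k * (m + 1).choose 3) := by
      rw [← zpow_natCast, ← zpow_mul, ← zpow_add₀ hz, Nat.choose_succ_succ' (m + 1) 1,
        Nat.choose_succ_succ' (m + 1) 2, Nat.choose_one_right]
      congr 1
      push_cast
      ring
    rw [prod_mul_distrib, prod_const, card_univ, Fintype.card_fin,
      Fin.prod_univ_eq_prod_range (fun i => h (i + 1)), key, hexp,
      Nat.choose_succ_succ' (m + 1) 1, Nat.choose_one_right, pow_add]
    simp only [Nat.cast_zero, mul_zero, add_zero]
    ring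

/-- The matrix of `m`-th powers of bilinear expressions factors through projective Vandermonde
matrices. -/
theorem det_of_add_pow {R : Type*} [CommRing R] (m : ℕ) (v w v' w' : Fin (m + 1) → R) :
    Matrix.det (Matrix.of fun i j => (v i * v' j + w i * w' j) ^ m)
      = (∏ i ∈ range (m + 1), (m.choose i : R))
        * ∏ i, ∏ j ∈ Ioi i, ((v j * w i - v i * w j) * (v' j * w' i - v' i * w' j)) := by
  have factor : Matrix.of (fun i j => (v i * v' j + w i * w' j) ^ m)
      = Matrix.projVandermonde v w
        * Matrix.diagonal (fun l : Fin (m + 1) => (m.choose l : R))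
        * (Matrix.projVandermonde v' w').transpose := by
    ext i j
    rw [Matrix.of_apply, Matrix.mul_apply, add_pow,
      ← Fin.sum_univ_eq_sum_range
        (fun l => (v i * v' j) ^ l * (w i * w' j) ^ (m - l) * (m.choose l : R))]
    refine sum_congr rfl fun l _ => ?_
    rw [Matrix.mul_diagonal, Matrix.transpose_apply, Matrix.projVandermonde_apply,
      Matrix.projVandermonde_apply, Fin.val_rev, Nat.add_sub_add_right]
    ring
  rw [factor, Matrix.det_mul, Matrix.det_mul, Matrix.det_transpose, Matrix.det_diagonal,
    Matrix.det_projVandermonde, Matrix.det_projVandermonde,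
    Fin.prod_univ_eq_prod_range (fun i => (m.choose i : R))]
  simp only [prod_mul_distrib]
  ring

theorem det_recurrence_pow (hc : c ≠ 0) (hP : ∀ n, P (n + 2) = e * P (n + 1) + c * P n)
    (hU : ∀ n, U (n + 2) = e * U (n + 1) + c * U n) (hU0 : U 0 = 0) (hU1 : U 1 = 1)
    (t k : ℤ) (m : ℕ) :
    Matrix.det (Matrix.of fun i j : Fin (m + 1) => P (t + k * (i : ℕ) + k * (j : ℕ)) ^ m)
      = (-1) ^ ((t + 1) * (m + 1).choose 2)
        * (P 1 ^ 2 - e * P 0 * P 1 - c * P 0 ^ 2) ^ (m + 1).choose 2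
        * c ^ (t * (m + 1).choose 2 + 2 * k * (m + 1).choose 3)
        * ∏ i ∈ range (m + 1), ((m.choose i : F) * U (k * (i + 1)) ^ (2 * (m - i))) := by
  have hc' : -c ≠ 0 := neg_ne_zero.mpr hc
  rw [show (Matrix.of fun i j : Fin (m + 1) => P (t + k * (i : ℕ) + k * (j : ℕ)) ^ m) = _ from
      congrArg Matrix.of (funext₂ fun i j => congrArg (· ^ m)
        (recurrence_add hc hP hU hU0 hU1 (t + k * (i : ℕ)) (k * (j : ℕ)))),
    det_of_add_pow m (fun i => P (t + k * (i : ℕ) + 1)) (fun i => P (t + k * (i : ℕ)))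
    (fun j => U (k * (j : ℕ))) (fun j => c * U (k * (j : ℕ) - 1))]
  set D := P 1 ^ 2 - e * P 0 * P 1 - c * P 0 ^ 2
  have pair (i j : Fin (m + 1)) (hij : i < j) :
      (P (t + k * (j : ℕ) + 1) * P (t + k * (i : ℕ))
          - P (t + k * (i : ℕ) + 1) * P (t + k * (j : ℕ)))
        * (U (k * (j : ℕ)) * (c * U (k * (i : ℕ) - 1))
          - U (k * (i : ℕ)) * (c * U (k * (j : ℕ) - 1)))
      = -D * (-c) ^ (t + 2 * k * (i : ℕ)) * U (k * ((j : ℕ) - (i : ℕ) : ℕ)) ^ 2 := by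
    have hP' := recurrence_dOcagne hc hP hU hU0 hU1 (t + k * (i : ℕ)) (k * ((j : ℕ) - (i : ℕ) : ℕ))
    have hU' := recurrence_dOcagne hc hU hU hU0 hU1 (k * (i : ℕ) - 1) (k * ((j : ℕ) - (i : ℕ) : ℕ))
    rw [Nat.cast_sub hij.le] at hP' hU' ⊢
    rw [show t + k * (i : ℕ) + k * ((j : ℕ) - (i : ℕ) : ℤ) = t + k * (j : ℕ) by ring] at hP'
    rw [show k * (i : ℕ) - 1 + k * ((j : ℕ) - (i : ℕ) : ℤ) = k * (j : ℕ) - 1 by ring,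
      sub_add_cancel, sub_add_cancel, hU0, hU1, zpow_sub_one₀ hc'] at hU'
    rw [hP', mul_left_comm _ c, mul_left_comm _ c, ← mul_sub, hU',
      show t + 2 * k * (i : ℕ) = t + k * (i : ℕ) + k * (i : ℕ) by ring,
      zpow_add₀ hc' (t + k * (i : ℕ))]
    field_simp
    ring
  rw [prod_congr rfl fun i _ => prod_congr rfl fun j hj => pair i j (mem_Ioi.mp hj),
    prod_Ioi_zpow_mul (-D) hc' (fun d => U (k * (d : ℕ)) ^ 2)]
  have sign : (-1 : F) ^ ((t + 1) * ((m + 1).choose 2 : ℤ))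
      = (-1) ^ (m + 1).choose 2
        * (-1) ^ (t * ((m + 1).choose 2 : ℤ) + 2 * k * ((m + 1).choose 3 : ℤ)) := by
    have h1 : (-1 : F) ≠ 0 := neg_ne_zero.mpr one_ne_zero
    rw [add_mul, one_mul, zpow_add₀ h1, zpow_natCast, zpow_add₀ h1, mul_assoc 2 k, zpow_mul _ 2,
      even_two.neg_one_zpow, one_zpow, mul_one, mul_comm]
  rw [sign, neg_pow D, ← neg_one_mul c, mul_zpow, prod_mul_distrib]
  simp only [← pow_mul, Nat.cast_add, Nat.cast_one]
  ring

end LinearRecurrence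

/-- **Theorem 2.** For `P = 𝒫(x)(p,q,r;a,b,c)` and `U = 𝒫(x)(0,0,1;a,b,c)` with `c ≠ 0`,
the determinant of the `(m+1)×(m+1)` matrix with entries `P_{s+k(n+i+j)}^m` equals
`(−1)^{(s+kn+1)·C(m+1,2)} · Δ_𝒫^{C(m+1,2)} · c^{(s+kn)·C(m+1,2)+2k·C(m+1,3)}
  · ∏_{i=0}^m C(m,i)·U_{k(i+1)}^{2(m−i)}`, as an identity in `ℝ(x)`. -/
theorem det_power_matrix_recurrence_polynomials
    (s k n : ℤ) (m : ℕ) (hm : 1 ≤ m)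
    (p q r a b c : ℝ) (hc : c ≠ 0)
    (P U : ℤ → Polynomial ℝ)
    (hP0 : P 0 = Polynomial.C p) (hP1 : P 1 = Polynomial.C q * X + Polynomial.C r)
    (hPrec : ∀ n : ℤ, P (n + 2) = (Polynomial.C a * X + Polynomial.C b) * P (n + 1)
      + Polynomial.C c * P n)
    (hU0 : U 0 = 0) (hU1 : U 1 = 1)
    (hUrec : ∀ n : ℤ, U (n + 2) = (Polynomial.C a * X + Polynomial.C b) * U (n + 1)
      + Polynomial.C c * U n) :
    Matrix.det (Matrix.of fun i j : Fin (m + 1) =>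
        (algebraMap (Polynomial ℝ) (RatFunc ℝ) (P (s + k * (n + i.1 + j.1)))) ^ m)
      = (-1 : RatFunc ℝ) ^ ((s + k * n + 1) * (Nat.choose (m + 1) 2 : ℤ))
        * (algebraMap (Polynomial ℝ) (RatFunc ℝ)
            (Polynomial.C (q ^ 2 - a * p * q) * X ^ 2
              + Polynomial.C (2 * q * r - a * p * r - b * p * q) * X
              + Polynomial.C (r ^ 2 - b * p * r - c * p ^ 2))) ^ (Nat.choose (m + 1) 2)
        * (algebraMap ℝ (RatFunc ℝ) c)
            ^ ((s + k * n) * (Nat.choose (m + 1) 2 : ℤ)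
                + 2 * k * (Nat.choose (m + 1) 3 : ℤ))
        * ∏ i ∈ Finset.range (m + 1),
            ((Nat.choose m i : RatFunc ℝ)
              * (algebraMap (Polynomial ℝ) (RatFunc ℝ) (U (k * ((i : ℤ) + 1))))
                  ^ (2 * (m - i))) := by
  have hc' : algebraMap ℝ (RatFunc ℝ) c ≠ 0 := by simpa using hc
  have hcC : algebraMap (Polynomial ℝ) (RatFunc ℝ) (Polynomial.C c)
      = algebraMap ℝ (RatFunc ℝ) c := by
    simp
  have lift {V : ℤ → Polynomial ℝ} (hV : ∀ n : ℤ, V (n + 2)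
      = (Polynomial.C a * X + Polynomial.C b) * V (n + 1) + Polynomial.C c * V n) (n : ℤ) :
      algebraMap (Polynomial ℝ) (RatFunc ℝ) (V (n + 2))
        = algebraMap (Polynomial ℝ) (RatFunc ℝ) (Polynomial.C a * X + Polynomial.C b)
            * algebraMap (Polynomial ℝ) (RatFunc ℝ) (V (n + 1))
          + algebraMap ℝ (RatFunc ℝ) c * algebraMap (Polynomial ℝ) (RatFunc ℝ) (V n) := by
    rw [hV n, map_add, map_mul, map_mul, hcC]
  have disc : Polynomial.C (q ^ 2 - a * p * q) * X ^ 2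
      + Polynomial.C (2 * q * r - a * p * r - b * p * q) * X
      + Polynomial.C (r ^ 2 - b * p * r - c * p ^ 2)
      = P 1 ^ 2 - (Polynomial.C a * X + Polynomial.C b) * P 0 * P 1
        - Polynomial.C c * P 0 ^ 2 := by
    rw [hP0, hP1]
    simp only [map_sub, map_mul, map_pow, map_ofNat]
    ring
  have main := det_recurrence_pow (P := fun n => algebraMap (Polynomial ℝ) (RatFunc ℝ) (P n))
    (U := fun n => algebraMap (Polynomial ℝ) (RatFunc ℝ) (U n)) hc' (lift hPrec) (lift hUrec)
    (by simp [hU0]) (by simp [hU1]) (s + k * n) k m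
  rw [disc]
  simp only [map_sub, map_mul (algebraMap (Polynomial ℝ) (RatFunc ℝ)), map_pow, hcC] at main ⊢
  rw [← main]
  congr! 7
  ring
end

section
/- Let m ≥ 1 and let K be the field of rational functions ℝ(x). Let B_i, D_i ∈ K for 0 ≤ i ≤ m, let A_j, C_j ∈ K for all j ∈ ℤ, and let (d_i)_{1≤i≤m} and (e_i)_{1≤i≤m} be sequences of integers. Then det( [ ∏_{f=j+1}^{m} (A_{d_f} B_i + C_{d_f} D_i) · ∏_{g=1}^{j} (A_{e_g} B_i + C_{e_g} D_i) ]_{0≤i,j≤m} ) = ∏_{0≤i<j≤m} (B_i D_j − B_j D_i) · ∏_{1≤i≤j≤m} (C_{e_i} A_{d_j} − A_{e_i} C_{d_j}). -/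
open Finset

section BinaryForms

variable {R : Type*} [CommRing R]

theorem exists_coeff_prod_linear_forms (a c : ℕ → R) (s : Finset ℕ) :
    ∃ q : ℕ → R, ∀ x y : R, ∏ f ∈ s, (a f * x + c f * y)
      = ∑ k ∈ range (#s + 1), y ^ k * x ^ (#s - k) * q k := by
  induction s using Finset.induction_on with
  | empty => exact ⟨fun _ => 1, by simp⟩
  | insert f s hf ih =>
    obtain ⟨q, hq⟩ := ih
    refine ⟨fun k => (if k ≤ #s then a f * q k else 0)
      + (if k = 0 then 0 else c f * q (k - 1)), fun x y => ?_⟩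
    rw [prod_insert hf, hq, card_insert_of_notMem hf, add_mul, mul_sum, mul_sum]
    simp only [mul_add, sum_add_distrib]
    congr 1
    · rw [sum_range_succ _ (#s + 1)]
      simp only [Nat.not_succ_le_self, if_false, mul_zero, add_zero]
      refine sum_congr rfl fun k hk => ?_
      have hk : k ≤ #s := Nat.lt_succ_iff.mp (mem_range.mp hk)
      rw [if_pos hk, Nat.succ_sub hk, pow_succ]
      ring
    · rw [sum_range_succ' _ (#s + 1)]
      simp only [if_true, mul_zero, add_zero, Nat.succ_ne_zero, if_false, Nat.add_sub_cancel,
        Nat.add_sub_add_right]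
      refine sum_congr rfl fun k _ => ?_
      ring

/-- The matrix of values at the points `(x i, y i)` of the binary forms
`∏_{j < f ≤ m} (a f * X + c f * Y) * ∏_{1 ≤ g ≤ j} (a' g * X + c' g * Y)`. -/
def linearFormMatrix (m : ℕ) (a c a' c' x y : ℕ → R) : Matrix (Fin (m + 1)) (Fin (m + 1)) R :=
  Matrix.of fun i j =>
    (∏ f ∈ Icc (j.1 + 1) m, (a f * x i.1 + c f * y i.1))
      * ∏ g ∈ Icc 1 j.1, (a' g * x i.1 + c' g * y i.1)

/-- The homogeneous Vandermonde product of the points `(x i, y i)` for `i ≤ m`. -/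
def vandermondeProd (m : ℕ) (x y : ℕ → R) : R :=
  ∏ j ∈ range (m + 1), ∏ i ∈ range j, (x i * y j - x j * y i)

theorem det_projVandermonde_eq_vandermondeProd (m : ℕ) (x y : ℕ → R) :
    (Matrix.projVandermonde (fun i : Fin (m + 1) => y i) (fun i => x i)).det
      = vandermondeProd m x y := by
  rw [Matrix.det_projVandermonde, vandermondeProd, prod_comm' (t' := univ) (s' := fun j => Iio j)
    (by simp), ← Fin.prod_univ_eq_prod_range]
  refine prod_congr rfl fun j _ => ?_
  rw [← Nat.Iio_eq_range, ← Fin.map_valEmbedding_Iio, prod_map]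
  refine prod_congr rfl fun i _ => ?_
  simp only [Fin.valEmbedding_apply]
  ring

theorem exists_linearFormMatrix_eq_projVandermonde_mul (m : ℕ) (a c a' c' : ℕ → R) :
    ∃ M : Matrix (Fin (m + 1)) (Fin (m + 1)) R, ∀ x y : ℕ → R,
      linearFormMatrix m a c a' c' x y
        = Matrix.projVandermonde (fun i => y i) (fun i => x i) * M := by
  choose q hq using fun j : Fin (m + 1) => exists_coeff_prod_linear_forms
    (fun k => if k ≤ j then a' k else a k) (fun k => if k ≤ j then c' k else c k) (Icc 1 m)
  refine ⟨Matrix.of fun k j => q j k, fun x y => ?_⟩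
  ext i j
  have h := hq j (x i) (y i)
  rw [Nat.card_Icc, Nat.add_sub_cancel, ← Fin.sum_univ_eq_sum_range
    (fun k => y i ^ k * x i ^ (m - k) * q j k)] at h
  rw [Matrix.mul_apply]
  simp only [Matrix.projVandermonde_apply, Matrix.of_apply, Fin.val_rev, Nat.add_sub_add_right]
  rw [← h, linearFormMatrix, Matrix.of_apply, mul_comm]
  have hj : j.1 ≤ m := Nat.lt_succ_iff.mp j.2
  have hdisj : Disjoint (Icc 1 j.1) (Icc (j.1 + 1) m) :=
    disjoint_left.mpr fun k hk hk' => by simp only [mem_Icc] at hk hk'; omega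
  have hunion : Icc 1 m = Icc 1 j.1 ∪ Icc (j.1 + 1) m := by
    ext k; simp only [mem_union, mem_Icc]; omega
  rw [hunion, prod_union hdisj]
  congr 1
  · refine prod_congr rfl fun k hk => ?_
    simp [(mem_Icc.mp hk).2]
  · refine prod_congr rfl fun k hk => ?_
    have hk : ¬ k ≤ j.1 := by have := (mem_Icc.mp hk).1; omega
    simp [hk]

/-- At the zeros `(-c i, a i)` of the forms `a i * X + c i * Y`, preceded by the point `(1, 0)`,
the matrix is upper triangular. -/
theorem det_linearFormMatrix_at_zeros (m : ℕ) (a c a' c' : ℕ → R) :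
    (linearFormMatrix m a c a' c' (fun i => if i = 0 then 1 else -c i)
        (fun i => if i = 0 then 0 else a i)).det
      = vandermondeProd m (fun i => if i = 0 then 1 else -c i) (fun i => if i = 0 then 0 else a i)
        * ∏ j ∈ Icc 1 m, ∏ i ∈ Icc 1 j, (c' i * a j - a' i * c j) := by
  rw [Matrix.det_of_isUpperTriangular]
  · simp only [linearFormMatrix, Matrix.of_apply]
    rw [prod_mul_distrib]
    congr 1
    · rw [Fin.prod_univ_eq_prod_range (fun j => ∏ f ∈ Icc (j + 1) m,
        (a f * (if j = 0 then 1 else -c j) + c f * (if j = 0 then 0 else a j))), vandermondeProd,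
        prod_comm' (t' := range (m + 1)) (s' := fun f => range f)
          (by intro j f; simp only [mem_range, mem_Icc]; omega)]
      refine prod_congr rfl fun f _ => prod_congr rfl fun j hj => ?_
      have hf : f ≠ 0 := by have := mem_range.mp hj; omega
      rw [if_neg hf, if_neg hf]
      ring
    · rw [Fin.prod_univ_eq_prod_range (fun j => ∏ g ∈ Icc 1 j,
        (a' g * (if j = 0 then 1 else -c j) + c' g * (if j = 0 then 0 else a j)))]
      symm
      refine prod_subset_one_on_sdiff (fun j => by simp only [mem_range, mem_Icc]; omega)
        (fun j hj => ?_) fun j hj => prod_congr rfl fun g _ => ?_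
      · have : j = 0 := by simp only [mem_sdiff, mem_range, mem_Icc] at hj; omega
        simp [this]
      · have hj : j ≠ 0 := by have := (mem_Icc.mp hj).1; omega
        rw [if_neg hj, if_neg hj]
        ring
  · intro i j hij
    have hij : j.1 < i.1 := hij
    have hi : i.1 ≠ 0 := by omega
    rw [linearFormMatrix, Matrix.of_apply]
    refine mul_eq_zero_of_left (prod_eq_zero (i := i.1) ?_ ?_) _
    · exact mem_Icc.mpr ⟨hij, Nat.lt_succ_iff.mp i.2⟩
    · rw [if_neg hi, if_neg hi]
      ring

theorem map_vandermondeProd {S : Type*} [CommRing S] (φ : R →+* S) (m : ℕ) (x y : ℕ → R) :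
    φ (vandermondeProd m x y) = vandermondeProd m (fun i => φ (x i)) (fun i => φ (y i)) := by
  simp [vandermondeProd, map_prod]

theorem map_det_linearFormMatrix {S : Type*} [CommRing S] (φ : R →+* S) (m : ℕ)
    (a c a' c' x y : ℕ → R) :
    φ (linearFormMatrix m a c a' c' x y).det
      = (linearFormMatrix m (fun i => φ (a i)) (fun i => φ (c i)) (fun i => φ (a' i))
          (fun i => φ (c' i)) (fun i => φ (x i)) (fun i => φ (y i))).det := by
  rw [RingHom.map_det]
  congr 1
  ext i j
  simp [linearFormMatrix, map_prod]

theorem det_linearFormMatrix_of_vandermondeProd_ne_zero [IsDomain R] (m : ℕ)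
    (a c a' c' x y : ℕ → R)
    (h : vandermondeProd m (fun i => if i = 0 then 1 else -c i)
      (fun i => if i = 0 then 0 else a i) ≠ 0) :
    (linearFormMatrix m a c a' c' x y).det
      = vandermondeProd m x y * ∏ j ∈ Icc 1 m, ∏ i ∈ Icc 1 j, (c' i * a j - a' i * c j) := by
  obtain ⟨M, hM⟩ := exists_linearFormMatrix_eq_projVandermonde_mul m a c a' c'
  have hz := det_linearFormMatrix_at_zeros m a c a' c'
  have hdet (x y : ℕ → R) :
      (linearFormMatrix m a c a' c' x y).det = vandermondeProd m x y * M.det := by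
    rw [hM, Matrix.det_mul, det_projVandermonde_eq_vandermondeProd]
  rw [hdet] at hz ⊢
  rw [mul_left_cancel₀ h hz]

open Polynomial in
theorem det_linearFormMatrix [IsDomain R] [CharZero R] (m : ℕ) (a c a' c' x y : ℕ → R) :
    (linearFormMatrix m a c a' c' x y).det
      = vandermondeProd m x y * ∏ j ∈ Icc 1 m, ∏ i ∈ Icc 1 j, (c' i * a j - a' i * c j) := by
  -- Deform `(a i, c i)` at `X = 0` to `(1, i)` at `X = 1`.
  have key := det_linearFormMatrix_of_vandermondeProd_ne_zero (R := R[X]) m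
    (fun i => (1 - X) * C (a i) + X) (fun i => (1 - X) * C (c i) + X * C (i : R))
    (fun i => C (a' i)) (fun i => C (c' i)) (fun i => C (x i)) (fun i => C (y i)) ?_
  · have h0 := congrArg (evalRingHom (0 : R)) key
    rw [map_mul, map_det_linearFormMatrix, map_vandermondeProd, map_prod] at h0
    simpa [map_prod, eval_prod] using h0
  · intro h
    have h1 := congrArg (evalRingHom (1 : R)) h
    rw [map_vandermondeProd, map_zero, vandermondeProd] at h1
    obtain ⟨j, -, hj⟩ := prod_eq_zero_iff.mp h1
    obtain ⟨i, hi, hij⟩ := prod_eq_zero_iff.mp hj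
    have hlt : i < j := mem_range.mp hi
    have hj0 : j ≠ 0 := by omega
    rcases eq_or_ne i 0 with rfl | hi0
    · simp [hj0] at hij
    · simp only [hi0, hj0, if_false] at hij
      simp [neg_add_eq_zero] at hij
      omega

end BinaryForms

/-- **Lemma 2.** For `B_i, D_i ∈ ℝ(x)` (`0 ≤ i ≤ m`), `A_j, C_j ∈ ℝ(x)` (`j ∈ ℤ`)
and integer sequences `(d_i)`, `(e_i)`,
`det([∏_{f=j+1}^m (A_{d_f} B_i + C_{d_f} D_i) · ∏_{g=1}^j (A_{e_g} B_i + C_{e_g} D_i)])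
 = ∏_{0≤i<j≤m} (B_i D_j − B_j D_i) · ∏_{1≤i≤j≤m} (C_{e_i} A_{d_j} − A_{e_i} C_{d_j})`. -/
theorem det_product_factorization_identity (m : ℕ) (hm : 1 ≤ m)
    (A C : ℤ → RatFunc ℝ) (B D : ℕ → RatFunc ℝ) (d e : ℕ → ℤ) :
    Matrix.det (Matrix.of fun i j : Fin (m + 1) =>
        (∏ f ∈ Finset.Icc (j.1 + 1) m, (A (d f) * B i.1 + C (d f) * D i.1))
          * ∏ g ∈ Finset.Icc 1 j.1, (A (e g) * B i.1 + C (e g) * D i.1))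
      = (∏ j ∈ Finset.range (m + 1), ∏ i ∈ Finset.range j, (B i * D j - B j * D i))
        * ∏ j ∈ Finset.Icc 1 m, ∏ i ∈ Finset.Icc 1 j,
            (C (e i) * A (d j) - A (e i) * C (d j)) := by
  exact det_linearFormMatrix m (fun i => A (d i)) (fun i => C (d i)) (fun i => A (e i))
    (fun i => C (e i)) B D
end

section
/- Let m ≥ 1 and let K be the field of rational functions ℝ(x). Let A_i, B_i, C_i, D_i ∈ K for 0 ≤ i ≤ m, and assume A_i D_j + B_i C_j ≠ 0 for all 0 ≤ i, j ≤ m. Then det( [ 1 / (A_i D_j + B_i C_j) ]_{0≤i,j≤m} ) = ( ∏_{0≤i<j≤m} (A_i B_j − A_j B_i)(C_i D_j − D_i C_j) ) / ( ∏_{0≤i,j≤m} (A_i D_j + B_i C_j) ). -/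
open Finset

/-- The Schur complement of the `(0, 0)` entry, when that entry is nonzero. -/
theorem Matrix.det_succ_eq_mul_det_schur {K : Type*} [Field K] {n : ℕ}
    (M : Matrix (Fin (n + 1)) (Fin (n + 1)) K) (h : M 0 0 ≠ 0) :
    M.det = M 0 0 * Matrix.det (Matrix.of fun i j : Fin n =>
      M i.succ j.succ - M i.succ 0 * M 0 j.succ / M 0 0) := by
  let c : Fin (n + 1) → K := Fin.cons 0 fun k : Fin n => M k.succ 0 / M 0 0
  let N : Matrix (Fin (n + 1)) (Fin (n + 1)) K := Matrix.of fun i j => M i j - c i * M 0 j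
  have hdet : M.det = N.det :=
    Matrix.det_eq_of_forall_row_eq_smul_add_const c 0 (by simp [c])
      (fun i j => by simp [N, c])
  have hcol : ∀ i : Fin n, N i.succ 0 = 0 := fun i => by simp [N, c, h]
  rw [hdet, Matrix.det_succ_column_zero, Fin.sum_univ_succ]
  simp only [hcol, mul_zero, zero_mul, Finset.sum_const_zero, add_zero]
  have h00 : N 0 0 = M 0 0 := by simp [N, c]
  rw [h00]
  simp only [Fin.val_zero, pow_zero, one_mul]
  congr 2
  ext i j
  simp [N, c, div_mul_eq_mul_div]

/-- The homogeneous Cauchy determinant over an arbitrary field. -/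
theorem Matrix.det_homogeneous_cauchy {K : Type*} [Field K] (n : ℕ) (A B C D : ℕ → K)
    (hne : ∀ i < n, ∀ j < n, A i * D j + B i * C j ≠ 0) :
    Matrix.det (Matrix.of fun i j : Fin n => (A i * D j + B i * C j)⁻¹)
      = (∏ j ∈ Finset.range n, ∏ i ∈ Finset.range j,
          ((A i * B j - A j * B i) * (C i * D j - D i * C j)))
        / ∏ i ∈ Finset.range n, ∏ j ∈ Finset.range n, (A i * D j + B i * C j) := by
  induction n generalizing A B C D with
  | zero => simp
  | succ n ih =>
    have h00 := hne 0 n.succ_pos 0 n.succ_pos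
    have hschur : (Matrix.of fun i j : Fin n =>
        (A (i + 1) * D (j + 1) + B (i + 1) * C (j + 1))⁻¹
          - (A (i + 1) * D 0 + B (i + 1) * C 0)⁻¹ * (A 0 * D (j + 1) + B 0 * C (j + 1))⁻¹
            / (A 0 * D 0 + B 0 * C 0)⁻¹)
        = Matrix.of fun i j : Fin n =>
          ((A 0 * B (i + 1) - A (i + 1) * B 0) / (A (i + 1) * D 0 + B (i + 1) * C 0)) *
          (Matrix.of fun i j : Fin n =>
            ((C 0 * D (j + 1) - D 0 * C (j + 1)) / (A 0 * D (j + 1) + B 0 * C (j + 1))) *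
            (Matrix.of fun i j : Fin n =>
              (A (i + 1) * D (j + 1) + B (i + 1) * C (j + 1))⁻¹) i j) i j := by
      ext i j
      have hij := hne (i + 1) (by lia) (j + 1) (by lia)
      have hi := hne (i + 1) (by lia) 0 (by lia)
      have hj := hne 0 (by lia) (j + 1) (by lia)
      simp only [Matrix.of_apply]
      rw [div_inv_eq_mul]
      generalize hx : A (i + 1) * D (j + 1) + B (i + 1) * C (j + 1) = x at *
      generalize hy : A (i + 1) * D 0 + B (i + 1) * C 0 = y at *
      generalize hz : A 0 * D (j + 1) + B 0 * C (j + 1) = z at *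
      field_simp
      rw [← hx, ← hy, ← hz]
      ring
    rw [Matrix.det_succ_eq_mul_det_schur _ (by simpa using h00)]
    simp only [Matrix.of_apply, Fin.val_zero, Fin.val_succ]
    rw [hschur, Matrix.det_mul_column, Matrix.det_mul_row,
      ih (fun i => A (i + 1)) (fun i => B (i + 1)) (fun i => C (i + 1)) (fun i => D (i + 1))
        fun i hi j hj => hne _ (by lia) _ (by lia)]
    rw [Fin.prod_univ_eq_prod_range
        (fun i => (A 0 * B (i + 1) - A (i + 1) * B 0) / (A (i + 1) * D 0 + B (i + 1) * C 0)),
      Fin.prod_univ_eq_prod_range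
        (fun j => (C 0 * D (j + 1) - D 0 * C (j + 1)) / (A 0 * D (j + 1) + B 0 * C (j + 1)))]
    simp only [Finset.prod_range_succ', Finset.prod_range_zero, Finset.prod_mul_distrib,
      Finset.prod_inv_distrib, mul_one, div_eq_mul_inv, mul_inv]
    ring

/-- **Lemma (Cauchy-type determinant).** For `A_i, B_i, C_i, D_i ∈ ℝ(x)` with all
`A_i D_j + B_i C_j ≠ 0`,
`det([1/(A_i D_j + B_i C_j)]) = ∏_{0≤i<j≤m} (A_i B_j − A_j B_i)(C_i D_j − D_i C_j)
  / ∏_{0≤i,j≤m} (A_i D_j + B_i C_j)`. -/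
theorem det_reciprocal_identity (m : ℕ) (hm : 1 ≤ m) (A B C D : ℕ → RatFunc ℝ)
    (hne : ∀ i j : Fin (m + 1), A i.1 * D j.1 + B i.1 * C j.1 ≠ 0) :
    Matrix.det (Matrix.of fun i j : Fin (m + 1) =>
        (A i.1 * D j.1 + B i.1 * C j.1)⁻¹)
      = (∏ j ∈ Finset.range (m + 1), ∏ i ∈ Finset.range j,
          ((A i * B j - A j * B i) * (C i * D j - D i * C j)))
        / ∏ i ∈ Finset.range (m + 1), ∏ j ∈ Finset.range (m + 1),
            (A i * D j + B i * C j) := by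
  exact Matrix.det_homogeneous_cauchy (m + 1) A B C D fun i hi j hj => hne ⟨i, hi⟩ ⟨j, hj⟩
end

section
/- Let m ≥ 2 and let A be an m×m matrix with entries in the field of rational functions ℝ(x). For 1 ≤ i, j and k with the relevant indices in range, let A_k(i,j) denote the determinant of the k×k contiguous submatrix of A whose top-left entry is at row i and column j of A (so A_k(i,j) uses rows i,…,i+k−1 and columns j,…,j+k−1). Then A_m(1,1)·A_{m−2}(2,2) = A_{m−1}(1,1)·A_{m−1}(2,2) − A_{m−1}(2,1)·A_{m−1}(1,2), where for m = 2 the (m−2)×(m−2) determinant A_0(2,2) is interpreted as 1 (the Desnanot–Jacobi identity). -/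
open Finset

/-- The determinant of the `k × k` contiguous submatrix of the `m × m` matrix `A`
whose top-left entry is at (0-indexed) row `i` and column `j` of `A`. -/
noncomputable def contiguousSubdet {m : ℕ} (A : Matrix (Fin m) (Fin m) (RatFunc ℝ))
    (i j k : ℕ) (hik : i + k ≤ m) (hjk : j + k ≤ m) : RatFunc ℝ :=
  Matrix.det (Matrix.of fun a b : Fin k =>
    A ⟨i + a.1, by have := a.isLt; omega⟩ ⟨j + b.1, by have := b.isLt; omega⟩)

namespace Matrix

variable {R : Type*} [CommRing R]

theorem det_mul_det_toBlocks₁₁_adjugate {k n : Type*} [Fintype k] [DecidableEq k] [Fintype n]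
    [DecidableEq n] (A : Matrix (k ⊕ n) (k ⊕ n) R) :
    A.det * A.adjugate.toBlocks₁₁.det = A.det ^ Fintype.card k * A.toBlocks₂₂.det := by
  have h := mul_adjugate A
  rw [← fromBlocks_toBlocks A.adjugate, ← fromBlocks_one, fromBlocks_smul] at h
  nth_rewrite 1 [← fromBlocks_toBlocks A] at h
  rw [fromBlocks_multiply, fromBlocks_inj] at h
  have key : A * fromBlocks A.adjugate.toBlocks₁₁ 0 A.adjugate.toBlocks₂₁ 1
      = fromBlocks (A.det • 1) A.toBlocks₁₂ 0 A.toBlocks₂₂ := by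
    nth_rewrite 1 [← fromBlocks_toBlocks A]
    rw [fromBlocks_multiply, h.1, h.2.2.1]
    simp
  simpa [det_fromBlocks_zero₁₂, det_fromBlocks_zero₂₁] using congrArg det key

/-- Jacobi's complementary minor formula for the `2 × 2` minors of the adjugate. -/
theorem det_toBlocks₁₁_adjugate {n : Type*} [Fintype n] [DecidableEq n]
    (A : Matrix (Fin 2 ⊕ n) (Fin 2 ⊕ n) R) :
    A.adjugate.toBlocks₁₁.det = A.det * A.toBlocks₂₂.det := by
  let G := mvPolynomialX (Fin 2 ⊕ n) (Fin 2 ⊕ n) ℤ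
  have hG : G.adjugate.toBlocks₁₁.det = G.det * G.toBlocks₂₂.det := by
    apply mul_left_cancel₀ (det_mvPolynomialX_ne_zero (Fin 2 ⊕ n) ℤ)
    rw [det_mul_det_toBlocks₁₁_adjugate, Fintype.card_fin]
    ring
  let f := MvPolynomial.eval₂Hom (Int.castRingHom R) fun p : (Fin 2 ⊕ n) × (Fin 2 ⊕ n) => A p.1 p.2
  have hA : f.mapMatrix G = A := mvPolynomialX_map_eval₂ (Int.castRingHom R) A
  have h := congrArg f hG
  rw [map_mul, RingHom.map_det, RingHom.map_det, RingHom.map_det, hA] at h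
  have h₁ : f.mapMatrix G.adjugate.toBlocks₁₁ = A.adjugate.toBlocks₁₁ := by
    rw [← hA, ← RingHom.map_adjugate]
    rfl
  have h₂ : f.mapMatrix G.toBlocks₂₂ = A.toBlocks₂₂ := by
    rw [← hA]
    rfl
  rwa [h₁, h₂] at h

/-- The equivalence sending the two elements of the left summand to the first and last elements
of `Fin (n + 2)`. -/
noncomputable def finTwoSumEquivEnds (n : ℕ) : Fin 2 ⊕ Fin n ≃ Fin (n + 2) :=
  Equiv.ofBijective (Sum.elim ![0, Fin.last (n + 1)] fun i => i.succ.castSucc) <| by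
    rw [Fintype.bijective_iff_injective_and_card]
    refine ⟨?_, by simp [add_comm]⟩
    rintro (i | i) (j | j) h
    · fin_cases i <;> fin_cases j <;> simp_all [Fin.ext_iff]
    · have := j.isLt
      fin_cases i <;> simp [Fin.ext_iff] at h
      omega
    · have := i.isLt
      fin_cases j <;> simp [Fin.ext_iff] at h
      omega
    · simpa [Fin.ext_iff] using h

theorem det_mul_det_submatrix_interior {n : ℕ} (A : Matrix (Fin (n + 2)) (Fin (n + 2)) R) :
    A.det * (A.submatrix (fun i : Fin n => i.succ.castSucc) fun i => i.succ.castSucc).det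
      = (A.submatrix Fin.castSucc Fin.castSucc).det * (A.submatrix Fin.succ Fin.succ).det
        - (A.submatrix Fin.succ Fin.castSucc).det * (A.submatrix Fin.castSucc Fin.succ).det := by
  have h := det_toBlocks₁₁_adjugate
    (A.submatrix (finTwoSumEquivEnds n) (finTwoSumEquivEnds n))
  have hI : (A.submatrix (finTwoSumEquivEnds n) (finTwoSumEquivEnds n)).toBlocks₂₂
      = A.submatrix (fun i : Fin n => i.succ.castSucc) fun i => i.succ.castSucc := rfl
  have e₀ : finTwoSumEquivEnds n (Sum.inl 0) = 0 := rfl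
  have e₁ : finTwoSumEquivEnds n (Sum.inl 1) = Fin.last (n + 1) := rfl
  rw [det_submatrix_equiv_self, hI, adjugate_submatrix_equiv_self, det_fin_two] at h
  simp only [toBlocks₁₁, of_apply, submatrix_apply, e₀, e₁,
    adjugate_fin_succ_eq_det_submatrix, Fin.succAbove_last, Fin.succAbove_zero, Fin.val_last,
    Fin.val_zero] at h
  rw [← h]
  have hs : ((-1 : R) ^ (n + 1)) * (-1) ^ (n + 1) = 1 := by rw [← mul_pow]; simp
  linear_combination ((A.submatrix Fin.castSucc Fin.castSucc).det *
    (A.submatrix Fin.succ Fin.succ).det - (A.submatrix Fin.succ Fin.castSucc).det *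
    (A.submatrix Fin.castSucc Fin.succ).det) * hs

end Matrix

/-- **Desnanot–Jacobi identity** for an `m × m` matrix `A` over `ℝ(x)` (`m ≥ 2`):
`A_m(1,1)·A_{m−2}(2,2) = A_{m−1}(1,1)·A_{m−1}(2,2) − A_{m−1}(2,1)·A_{m−1}(1,2)`,
where (in 0-indexed form) `A_k(i+1,j+1)` is `contiguousSubdet A i j k`. -/
theorem desnanot_jacobi (m : ℕ) (hm : 2 ≤ m) (A : Matrix (Fin m) (Fin m) (RatFunc ℝ)) :
    contiguousSubdet A 0 0 m (by omega) (by omega)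
        * contiguousSubdet A 1 1 (m - 2) (by omega) (by omega)
      = contiguousSubdet A 0 0 (m - 1) (by omega) (by omega)
          * contiguousSubdet A 1 1 (m - 1) (by omega) (by omega)
        - contiguousSubdet A 1 0 (m - 1) (by omega) (by omega)
          * contiguousSubdet A 0 1 (m - 1) (by omega) (by omega) := by
  obtain ⟨n, rfl⟩ := Nat.exists_eq_add_of_le' hm
  have h := Matrix.det_mul_det_submatrix_interior A
  convert h using 3 <;> unfold contiguousSubdet <;> congr 1 <;> ext a b <;>
    simp only [Matrix.of_apply, Matrix.submatrix_apply] <;> congr 1 <;> ext <;>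
    simp [add_comm]
end

section
/- Let n be any integer, m ≥ 1, and 1 ≤ d ≤ m+1. Let p, q, r, a, b, c be real numbers with c ≠ 0. Let (P_n)_{n∈ℤ} = 𝒫(x)(p,q,r;a,b,c) and (U_n)_{n∈ℤ} = 𝒫(x)(0,0,1;a,b,c). Then the determinant of the d×d matrix with (i,j) entry P_{n+i+j}^{⟨m⟩} (indices 0 ≤ i, j ≤ d−1) equals (−1)^{n·C(d,2) + C(d+1,3)} · c^{(n+d−2)·C(d,2)} · Δ_𝒫^{C(d,2)} · ∏_{i=1}^{d−1} ( U_i · U_{m+1−i} )^{d−i} · ∏_{i=d−1}^{2(d−1)} P_{n+i}^{⟨m+1−d⟩}, where Δ_𝒫 is the discriminant of 𝒫(x)(p,q,r;a,b,c), C(·,·) are binomial coefficients, and powers of −1 and c with (possibly negative) integer exponents are integer powers (well-defined since c ≠ 0); this is an identity in the field of rational functions ℝ(x). -/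
open Polynomial Finset

namespace RisingPowerDet

section BinaryForms

variable {K : Type*} [Field K]

/-- A product of `N` linear forms in two variables is a binary form of degree `N`. -/
theorem exists_coeff_prod_linear_forms (N : ℕ) (α β : ℕ → K) :
    ∃ e : ℕ → K, ∀ x y : K, ∏ k ∈ range N, (α k * x + β k * y)
      = ∑ k ∈ range (N + 1), x ^ k * y ^ (N - k) * e k := by
  induction N with
  | zero => exact ⟨fun _ => 1, fun x y => by simp⟩
  | succ N ih =>
    obtain ⟨e, he⟩ := ih
    refine ⟨fun k => (if k = 0 then 0 else α N * e (k - 1))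
      + (if k = N + 1 then 0 else β N * e k), fun x y => ?_⟩
    rw [prod_range_succ, he]
    simp only [mul_add, sum_add_distrib]
    congr 1
    · rw [sum_range_succ' _ (N + 1)]
      simp only [Nat.add_sub_add_right, Nat.add_eq_zero_iff, one_ne_zero, and_false, if_false,
        Nat.add_sub_cancel, if_true, mul_zero, add_zero, sum_mul]
      exact sum_congr rfl fun k _ => by ring
    · rw [sum_range_succ _ (N + 1)]
      simp only [if_true, mul_zero, add_zero, sum_mul]
      refine sum_congr rfl fun k hk => ?_
      have hk' := mem_range.mp hk
      rw [if_neg (by omega), show N + 1 - k = N - k + 1 by omega]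
      ring

/-- The matrix with rows `A_i ⋯ A_{N-1} · B_0 ⋯ B_{i-1}` evaluated at the points `(v_j, w_j)`, where
`A_k = α_k x + β_k y` and `B_k = γ_k x + δ_k y`. -/
def formMatrix (N : ℕ) (α β γ δ : ℕ → K) (v w : Fin (N + 1) → K) :
    Matrix (Fin (N + 1)) (Fin (N + 1)) K :=
  Matrix.of fun i j => (∏ k ∈ range (N - i), (α (i + k) * v j + β (i + k) * w j))
    * ∏ k ∈ range i, (γ k * v j + δ k * w j)

theorem exists_det_formMatrix_eq (N : ℕ) (α β γ δ : ℕ → K) :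
    ∃ D : K, ∀ v w : Fin (N + 1) → K,
      (formMatrix N α β γ δ v w).det = (Matrix.projVandermonde v w).det * D := by
  have h (i : Fin (N + 1)) := exists_coeff_prod_linear_forms N
    (fun k => if k < N - i then α (i + k) else γ (k - (N - i)))
    (fun k => if k < N - i then β (i + k) else δ (k - (N - i)))
  choose e he using h
  refine ⟨(Matrix.of fun k i : Fin (N + 1) => e i k).det, fun v w => ?_⟩
  rw [← Matrix.det_mul, ← Matrix.det_transpose]
  congr 1
  ext j i
  rw [Matrix.mul_apply]
  have := he i (v j) (w j)
  rw [← Fin.sum_univ_eq_sum_range (fun k => v j ^ k * w j ^ (N - k) * e i k)] at this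
  simp only [formMatrix, Matrix.transpose_apply, Matrix.of_apply, Matrix.projVandermonde_apply,
    Fin.val_rev]
  simp only [Nat.add_sub_add_right]
  rw [← this, ← prod_range_mul_prod_Ico _ (Nat.sub_le N i), prod_Ico_eq_prod_range,
    Nat.sub_sub_self (by omega)]
  congr 1
  · refine prod_congr rfl fun k hk => ?_
    simp [mem_range.mp hk]
  · refine prod_congr rfl fun k hk => ?_
    simp

theorem prod_triangle_succ {M : Type*} [CommMonoid M] (N : ℕ) (f : ℕ → ℕ → M) :
    ∏ k ∈ range (N + 1), ∏ i ∈ range (k + 1), f k i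
      = (∏ k ∈ range (N + 1), f k 0) * ∏ k ∈ range N, ∏ i ∈ range (k + 1), f (k + 1) (i + 1) := by
  rw [prod_congr rfl fun k _ => prod_range_succ' (f k) k, prod_mul_distrib, mul_comm,
    prod_range_succ' fun k => ∏ i ∈ range k, f k (i + 1)]
  simp

theorem det_formMatrix_succ (N : ℕ) (α β γ δ : ℕ → K) (v w : Fin (N + 1) → K) :
    (formMatrix (N + 1) α β γ δ (Fin.cons (δ 0) v) (Fin.cons (-γ 0) w)).det
      = (∏ k ∈ range (N + 1), (α k * δ 0 - β k * γ 0)) * ((∏ j, (γ 0 * v j + δ 0 * w j))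
        * (formMatrix N (fun k => α (k + 1)) (fun k => β (k + 1)) (fun k => γ (k + 1))
            (fun k => δ (k + 1)) v w).det) := by
  rw [Matrix.det_succ_column_zero, Fin.sum_univ_succ, sum_eq_zero, add_zero]
  · simp only [Fin.val_zero, pow_zero, one_mul]
    rw [← Matrix.det_mul_row]
    congr 1
    · simp [formMatrix, sub_eq_add_neg]
    · congr 1
      ext i j
      simp only [formMatrix, Matrix.submatrix_apply, Matrix.of_apply, Fin.succAbove_zero,
        Fin.cons_succ, Fin.val_succ, Nat.add_sub_add_right]
      rw [prod_range_succ' _ (i : ℕ)]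
      simp only [add_right_comm]
      ring
  · intro i _
    have : formMatrix (N + 1) α β γ δ (Fin.cons (δ 0) v) (Fin.cons (-γ 0) w) i.succ 0 = 0 := by
      simp only [formMatrix, Matrix.of_apply, Fin.val_succ, prod_range_succ' _ (i : ℕ),
        Fin.cons_zero]
      ring
    rw [this]
    ring

theorem det_projVandermonde_cons (N : ℕ) (x y : K) (v w : Fin (N + 1) → K) :
    (Matrix.projVandermonde (Fin.cons x v : Fin (N + 2) → K) (Fin.cons y w)).det
      = (∏ j, (v j * y - x * w j)) * (Matrix.projVandermonde v w).det := by
  simp only [Matrix.det_projVandermonde]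
  rw [Fin.prod_univ_succ]
  simp [Fin.prod_Ioi_succ]

theorem exists_points [CharZero K] (N : ℕ) (γ δ : K) (h : γ ≠ 0 ∨ δ ≠ 0) :
    ∃ v w : Fin (N + 1) → K, (∏ j, (γ * v j + δ * w j)) ≠ 0 ∧
      (Matrix.projVandermonde v w).det ≠ 0 := by
  obtain ⟨x, y, hxy⟩ : ∃ x y : K, γ * x + δ * y ≠ 0 := by
    rcases h with h | h
    · exact ⟨1, 0, by simpa⟩
    · exact ⟨0, 1, by simpa⟩
  refine ⟨fun j => x + (j : ℕ) * δ, fun j => y - (j : ℕ) * γ, ?_, ?_⟩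
  · refine prod_ne_zero_iff.mpr fun j _ => ?_
    convert hxy using 1
    ring
  · rw [Matrix.det_projVandermonde]
    refine prod_ne_zero_iff.mpr fun i _ => prod_ne_zero_iff.mpr fun j hj => ?_
    have hij : ((j : ℕ) : K) - (i : ℕ) ≠ 0 := by
      rw [sub_ne_zero, Ne, Nat.cast_inj, Fin.val_inj]
      exact (mem_Ioi.mp hj).ne'
    convert mul_ne_zero hij hxy using 1
    ring

/-- A homogeneous version of Krattenthaler's determinant lemma. -/
theorem det_formMatrix [CharZero K] (N : ℕ) (α β γ δ : ℕ → K) (v w : Fin (N + 1) → K) :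
    (formMatrix N α β γ δ v w).det = (Matrix.projVandermonde v w).det
      * ∏ k ∈ range N, ∏ i ∈ range (k + 1), (β k * γ i - α k * δ i) := by
  induction N generalizing α β γ δ with
  | zero => simp [formMatrix, Matrix.projVandermonde_apply]
  | succ N ih =>
    obtain ⟨D, hD⟩ := exists_det_formMatrix_eq (N + 1) α β γ δ
    rw [hD, prod_triangle_succ]
    congr 1
    by_cases h : γ 0 ≠ 0 ∨ δ 0 ≠ 0
    · obtain ⟨v', w', h₁, h₂⟩ := exists_points N (γ 0) (δ 0) h
      have h₃ := hD (Fin.cons (δ 0) v') (Fin.cons (-γ 0) w')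
      rw [det_formMatrix_succ, ih, det_projVandermonde_cons] at h₃
      have h₄ : ∏ j, (v' j * -γ 0 - δ 0 * w' j)
          = (-1) ^ (N + 1) * ∏ j, (γ 0 * v' j + δ 0 * w' j) := by
        rw [show (-1 : K) ^ (N + 1) = ∏ _j : Fin (N + 1), (-1) by simp, ← prod_mul_distrib]
        exact prod_congr rfl fun j _ => by ring
      have h₅ : ∏ k ∈ range (N + 1), (α k * δ 0 - β k * γ 0)
          = (-1) ^ (N + 1) * ∏ k ∈ range (N + 1), (β k * γ 0 - α k * δ 0) := by
        rw [show (-1 : K) ^ (N + 1) = ∏ _j ∈ range (N + 1), (-1) by simp, ← prod_mul_distrib]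
        exact prod_congr rfl fun j _ => by ring
      rw [h₄, h₅] at h₃
      have h₆ : (-1 : K) ^ (N + 1) ≠ 0 := pow_ne_zero _ (by simp)
      apply mul_left_cancel₀ (mul_ne_zero (mul_ne_zero h₆ h₁) h₂)
      rw [← h₃]
      ring
    · push Not at h
      obtain ⟨v', w', -, h₂⟩ := exists_points (N + 1) (1 : K) 0 (by simp)
      have h₃ := hD v' w'
      rw [Matrix.det_eq_zero_of_row_eq_zero (Fin.last (N + 1))] at h₃
      · have : D = 0 := by simpa [h₂] using h₃.symm
        rw [this, prod_range_succ' _ N]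
        simp [h]
      · intro j
        simp [formMatrix, prod_range_succ', h]

end BinaryForms

section Products

variable {M : Type*} [CommMonoid M]

theorem prod_triangle_sub (N : ℕ) (g : ℕ → M) :
    ∏ k ∈ range N, ∏ i ∈ range (k + 1), g (k - i) = ∏ e ∈ range N, g e ^ (N - e) := by
  induction N with
  | zero => simp
  | succ N ih =>
    have h : ∏ i ∈ range (N + 1), g (N - i) = ∏ i ∈ range (N + 1), g i :=
      prod_range_reflect g (N + 1)
    rw [prod_range_succ, ih, h, prod_range_succ, prod_range_succ _ N, ← mul_assoc,
      ← prod_mul_distrib, Nat.add_sub_cancel_left, pow_one]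
    congr 1
    refine prod_congr rfl fun e he => ?_
    rw [Nat.sub_add_comm (mem_range.mp he).le, pow_succ]

theorem prod_univ_prod_Ioi (N : ℕ) (f : ℕ → ℕ → M) :
    ∏ i : Fin (N + 1), ∏ j ∈ Ioi i, f i j = ∏ k ∈ range N, ∏ i ∈ range (k + 1), f i (k + 1) := by
  induction N generalizing f with
  | zero => simp
  | succ N ih =>
    rw [Fin.prod_univ_succ, prod_triangle_succ, Fin.prod_Ioi_zero]
    simp only [Fin.prod_Ioi_succ, Fin.val_succ, Fin.val_zero]
    rw [ih fun i j => f (i + 1) (j + 1), Fin.prod_univ_eq_prod_range (fun k => f 0 (k + 1))]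

end Products

section Recurrence

variable {K : Type*} [Field K] {t c : K} {P U : ℤ → K}

theorem eq_zero_of_recurrence (hc : c ≠ 0)
    (hP : ∀ n : ℤ, P (n + 2) = t * P (n + 1) + c * P n) (h0 : P 0 = 0) (h1 : P 1 = 0) (n : ℤ) :
    P n = 0 := by
  suffices h : P n = 0 ∧ P (n + 1) = 0 from h.1
  induction n with
  | zero => exact ⟨h0, by simpa using h1⟩
  | succ n ih => exact ⟨ih.2, by rw [add_assoc, one_add_one_eq_two, hP, ih.1, ih.2]; simp⟩
  | pred n ih =>
    have h := hP (-n - 1)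
    rw [show (-n - 1 + 2 : ℤ) = -n + 1 by ring, show (-n - 1 + 1 : ℤ) = -n by ring, ih.1, ih.2]
      at h
    refine ⟨by simpa [hc] using h, ?_⟩
    rw [show (-n - 1 + 1 : ℤ) = -n by ring, ih.1]

theorem shift_eq (hc : c ≠ 0) (hP : ∀ n : ℤ, P (n + 2) = t * P (n + 1) + c * P n)
    (hU : ∀ n : ℤ, U (n + 2) = t * U (n + 1) + c * U n) (hU0 : U 0 = 0) (hU1 : U 1 = 1)
    (s k : ℤ) : P (s + k) = c * U (k - 1) * P s + U k * P (s + 1) := by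
  have hU' : c * U (-1) = 1 := by
    have h := hU (-1)
    norm_num [hU0, hU1] at h
    exact h.symm
  rw [← sub_eq_zero]
  refine eq_zero_of_recurrence (t := t) hc
    (P := fun k => P (s + k) - (c * U (k - 1) * P s + U k * P (s + 1))) (fun k => ?_) ?_ ?_ k
  · have h := hU (k - 1)
    rw [show k - 1 + 2 = k + 1 by ring, show k - 1 + 1 = k by ring] at h
    simp only [← add_assoc, hP, hU, show k + 2 - 1 = k + 1 by ring, h, add_sub_cancel_right]
    ring
  · simp [hU0, hU']
  · simp [hU0, hU1]

theorem cassini (hc : c ≠ 0) (hP : ∀ n : ℤ, P (n + 2) = t * P (n + 1) + c * P n) (s : ℤ) :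
    P (s + 1) ^ 2 - t * P s * P (s + 1) - c * P s ^ 2
      = (-c) ^ s * (P 1 ^ 2 - t * P 0 * P 1 - c * P 0 ^ 2) := by
  have step (s : ℤ) : P (s + 1 + 1) ^ 2 - t * P (s + 1) * P (s + 1 + 1) - c * P (s + 1) ^ 2
      = -c * (P (s + 1) ^ 2 - t * P s * P (s + 1) - c * P s ^ 2) := by
    rw [add_assoc, one_add_one_eq_two, hP]
    ring
  have hc' : -c ≠ 0 := neg_ne_zero.mpr hc
  induction s with
  | zero => simp
  | succ n ih => rw [step, ih, zpow_add_one₀ hc']; ring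
  | pred n ih =>
    have h := step (-n - 1)
    rw [sub_add_cancel, ih] at h
    apply mul_left_cancel₀ hc'
    rw [sub_add_cancel, ← h, ← mul_assoc, ← zpow_one_add₀ hc']
    congr 2
    ring

theorem docagne (hc : c ≠ 0) (hP : ∀ n : ℤ, P (n + 2) = t * P (n + 1) + c * P n)
    (hU : ∀ n : ℤ, U (n + 2) = t * U (n + 1) + c * U n) (hU0 : U 0 = 0) (hU1 : U 1 = 1)
    (s e : ℤ) : P (s + e) * P (s + 1) - P s * P (s + e + 1)
      = (-c) ^ s * (P 1 ^ 2 - t * P 0 * P 1 - c * P 0 ^ 2) * U e := by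
  have h := hU (e - 1)
  rw [show e - 1 + 2 = e + 1 by ring, show e - 1 + 1 = e by ring] at h
  rw [← cassini hc hP, add_assoc s, shift_eq hc hP hU hU0 hU1 s e,
    shift_eq hc hP hU hU0 hU1 s (e + 1), h, add_sub_cancel_right]
  ring

theorem prod_range_neg_zpow (hc : c ≠ 0) (x Δ : K) (n : ℤ) (M : ℕ) :
    ∏ i ∈ range M, (-((-c) ^ (n + i) * x * Δ))
      = (-1) ^ M * (-c) ^ (n * M + (M.choose 2 : ℤ)) * x ^ M * Δ ^ M := by
  induction M with
  | zero => simp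
  | succ M ih =>
    have h : n * ((M + 1 : ℕ) : ℤ) + ((M + 1).choose 2 : ℤ)
        = n * M + (M.choose 2 : ℤ) + (n + M) := by
      rw [Nat.choose_succ_succ' M 1, Nat.choose_one_right]
      push_cast
      ring
    rw [prod_range_succ, ih, h, zpow_add₀ (neg_ne_zero.mpr hc) _ (n + M)]
    ring

theorem prod_triangle_zpow (hc : c ≠ 0) (Δ : K) (n : ℤ) (N : ℕ) :
    ∏ k ∈ range N, ∏ i ∈ range (k + 1), (-((-c) ^ (n + i) * (-c) ^ k * Δ))
      = (-1) ^ (n * ((N + 1).choose 2 : ℤ) + ((N + 2).choose 3 : ℤ))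
        * c ^ ((n + (N : ℤ) - 1) * ((N + 1).choose 2 : ℤ)) * Δ ^ ((N + 1).choose 2) := by
  induction N with
  | zero => simp
  | succ N ih =>
    have h₂ : (N + 1 + 1).choose 2 = (N + 1).choose 2 + (N + 1) := by
      rw [Nat.choose_succ_succ' (N + 1) 1, Nat.choose_one_right, add_comm]
    have h₃ : (N + 1 + 2).choose 3 = (N + 2).choose 3 + ((N + 1).choose 2 + (N + 1)) := by
      rw [Nat.choose_succ_succ' (N + 2) 2, ← h₂, add_comm]
    have hneg : (-1 : K) ≠ 0 := by simp
    have hsign : (-1 : K) ^ (N * (N + 1)) = 1 := (Nat.even_mul_succ_self N).neg_one_pow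
    rw [prod_range_succ, ih, prod_range_neg_zpow hc, h₂, h₃, ← pow_mul, pow_add Δ,
      neg_pow c (N * (N + 1)), hsign, one_mul, neg_eq_neg_one_mul c, mul_zpow,
      show n * (((N + 1).choose 2 + (N + 1) : ℕ) : ℤ)
          + (((N + 2).choose 3 + ((N + 1).choose 2 + (N + 1)) : ℕ) : ℤ)
        = n * ((N + 1).choose 2 : ℤ) + ((N + 2).choose 3 : ℤ)
          + ((n * (N + 1 : ℕ) + ((N + 1).choose 2 : ℤ)) + (N + 1 : ℕ)) by push_cast; ring,
      show (n + ((N + 1 : ℕ) : ℤ) - 1) * (((N + 1).choose 2 + (N + 1) : ℕ) : ℤ)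
        = (n + (N : ℤ) - 1) * ((N + 1).choose 2 : ℤ)
          + ((n * (N + 1 : ℕ) + ((N + 1).choose 2 : ℤ)) + (N * (N + 1) : ℕ)) by push_cast; ring]
    simp only [zpow_add₀ hneg _ (_ + _), zpow_add₀ hneg _ ((N + 1 : ℕ) : ℤ),
      zpow_add₀ hc _ (_ + _), zpow_add₀ hc _ ((N * (N + 1) : ℕ) : ℤ), zpow_natCast]
    ring

theorem det_rising_power [CharZero K] (hc : c ≠ 0)
    (hP : ∀ n : ℤ, P (n + 2) = t * P (n + 1) + c * P n)
    (hU : ∀ n : ℤ, U (n + 2) = t * U (n + 1) + c * U n) (hU0 : U 0 = 0) (hU1 : U 1 = 1)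
    (n : ℤ) (m N : ℕ) (hN : N ≤ m) :
    (Matrix.of fun i j : Fin (N + 1) => ∏ u ∈ range m, P (n + i.1 + j.1 + u)).det
      = (-1) ^ (n * ((N + 1).choose 2 : ℤ) + ((N + 2).choose 3 : ℤ))
        * c ^ ((n + (N : ℤ) - 1) * ((N + 1).choose 2 : ℤ))
        * (P 1 ^ 2 - t * P 0 * P 1 - c * P 0 ^ 2) ^ ((N + 1).choose 2)
        * (∏ e ∈ range N, (U (e + 1) * U (m - e)) ^ (N - e))
        * ∏ j ∈ range (N + 1), ∏ u ∈ range (m - N), P (n + N + j + u) := by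
  have hM : (Matrix.of fun i j : Fin (N + 1) => ∏ u ∈ range m, P (n + i.1 + j.1 + u))
      = Matrix.of fun i j : Fin (N + 1) => (∏ u ∈ range (m - N), P (n + N + j.1 + u))
        * formMatrix N (fun k => c * U (k - 1)) (fun k => U k) (fun k => c * U ((m + k : ℕ) - 1))
          (fun k => U (m + k : ℕ)) (fun j => P (n + j.1)) (fun j => P (n + j.1 + 1)) i j := by
    ext i j
    simp only [formMatrix, Matrix.of_apply, ← shift_eq hc hP hU hU0 hU1]
    have hm : m = N - i + (m - N) + i := by omega
    conv_lhs => rw [hm, prod_range_add, prod_range_add]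
    rw [mul_comm (∏ u ∈ range (N - i), _), mul_assoc]
    congr 1
    · refine prod_congr rfl fun u _ => congrArg P ?_
      push_cast [show (i : ℕ) ≤ N by omega]
      ring
    · congr 1
      · refine prod_congr rfl fun u _ => congrArg P ?_
        push_cast
        ring
      · refine prod_congr rfl fun u _ => congrArg P ?_
        push_cast [show (i : ℕ) ≤ N by omega, hN]
        ring
  rw [hM, Matrix.det_mul_row, det_formMatrix, Matrix.det_projVandermonde,
    prod_univ_prod_Ioi N fun i j => P (n + j) * P (n + i + 1) - P (n + i) * P (n + j + 1),
    ← prod_mul_distrib, Fin.prod_univ_eq_prod_range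
      (fun j => ∏ u ∈ range (m - N), P (n + N + j + u)), mul_comm (∏ j ∈ range (N + 1), _)]
  congr 1
  rw [← prod_triangle_zpow hc, ← prod_triangle_sub N fun e => U (e + 1) * U (m - e),
    ← prod_mul_distrib]
  refine prod_congr rfl fun k hk => ?_
  rw [← prod_mul_distrib, ← prod_mul_distrib]
  refine prod_congr rfl fun i hi => ?_
  have hik : i ≤ k := by simpa [Nat.lt_succ_iff] using hi
  have h₁ := docagne hc hP hU hU0 hU1 (n + i) (k + 1 - i)
  have h₂ := docagne hc hU hU hU0 hU1 (k - 1) (m + i - k)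
  have h₃ : (-c) ^ k = -c * (-c) ^ ((k : ℤ) - 1) := by
    rw [← zpow_one_add₀ (neg_ne_zero.mpr hc), add_sub_cancel, zpow_natCast]
  rw [show n + i + (k + 1 - i) = n + ((k + 1 : ℕ) : ℤ) by push_cast; ring] at h₁
  rw [show (k : ℤ) - 1 + (m + i - k) = ((m + i : ℕ) : ℤ) - 1 by push_cast; ring,
    sub_add_cancel, sub_add_cancel, hU0, hU1] at h₂
  rw [h₁, h₃]
  push_cast [hik] at h₂ ⊢
  rw [show (k : ℤ) - i + 1 = k + 1 - i by ring, show (m : ℤ) - (k - i) = m + i - k by ring]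
  linear_combination (c * (-c) ^ (n + i) * (P 1 ^ 2 - t * P 0 * P 1 - c * P 0 ^ 2)
    * U (k + 1 - i)) * h₂

end Recurrence

end RisingPowerDet

/-- **Theorem 4.** For `P = 𝒫(x)(p,q,r;a,b,c)` and `U = 𝒫(x)(0,0,1;a,b,c)` with `c ≠ 0`,
`m ≥ 1` and `1 ≤ d ≤ m+1`, the determinant of the `d×d` matrix with `(i,j)` entry the
rising power `P_{n+i+j}^{⟨m⟩}` equals
`(−1)^{n·C(d,2)+C(d+1,3)} · c^{(n+d−2)·C(d,2)} · Δ_𝒫^{C(d,2)}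
 · ∏_{i=1}^{d−1} (U_i U_{m+1−i})^{d−i} · ∏_{i=d−1}^{2(d−1)} P_{n+i}^{⟨m+1−d⟩}`,
as an identity in `ℝ(x)`. -/
theorem det_rising_power_matrix_recurrence_polynomials
    (n : ℤ) (m d : ℕ) (hm : 1 ≤ m) (hd : 1 ≤ d) (hdm : d ≤ m + 1)
    (p q r a b c : ℝ) (hc : c ≠ 0)
    (P U : ℤ → Polynomial ℝ)
    (hP0 : P 0 = Polynomial.C p) (hP1 : P 1 = Polynomial.C q * X + Polynomial.C r)
    (hPrec : ∀ n : ℤ, P (n + 2) = (Polynomial.C a * X + Polynomial.C b) * P (n + 1)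
      + Polynomial.C c * P n)
    (hU0 : U 0 = 0) (hU1 : U 1 = 1)
    (hUrec : ∀ n : ℤ, U (n + 2) = (Polynomial.C a * X + Polynomial.C b) * U (n + 1)
      + Polynomial.C c * U n) :
    Matrix.det (Matrix.of fun i j : Fin d =>
        algebraMap (Polynomial ℝ) (RatFunc ℝ)
          (∏ u ∈ Finset.range m, P (n + i.1 + j.1 + u)))
      = (-1 : RatFunc ℝ) ^ (n * (Nat.choose d 2 : ℤ) + (Nat.choose (d + 1) 3 : ℤ))
        * (algebraMap ℝ (RatFunc ℝ) c) ^ ((n + (d : ℤ) - 2) * (Nat.choose d 2 : ℤ))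
        * (algebraMap (Polynomial ℝ) (RatFunc ℝ)
            (Polynomial.C (q ^ 2 - a * p * q) * X ^ 2
              + Polynomial.C (2 * q * r - a * p * r - b * p * q) * X
              + Polynomial.C (r ^ 2 - b * p * r - c * p ^ 2))) ^ (Nat.choose d 2)
        * (∏ i ∈ Finset.Icc 1 (d - 1),
            (algebraMap (Polynomial ℝ) (RatFunc ℝ)
                (U (i : ℤ) * U ((m : ℤ) + 1 - (i : ℤ)))) ^ (d - i))
        * ∏ i ∈ Finset.Icc (d - 1) (2 * (d - 1)),
            algebraMap (Polynomial ℝ) (RatFunc ℝ)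
              (∏ u ∈ Finset.range (m + 1 - d), P (n + i + u)) := by
  obtain ⟨N, rfl⟩ : ∃ N, d = N + 1 := ⟨d - 1, by omega⟩
  have hc' : algebraMap ℝ (RatFunc ℝ) c ≠ 0 := by simpa using hc
  have hC : algebraMap ℝ (RatFunc ℝ) c = algebraMap (Polynomial ℝ) (RatFunc ℝ) (C c) :=
    IsScalarTower.algebraMap_apply ℝ (Polynomial ℝ) (RatFunc ℝ) c
  have key := RisingPowerDet.det_rising_power
    (t := algebraMap (Polynomial ℝ) (RatFunc ℝ) (C a * X + C b))
    (P := fun k => algebraMap (Polynomial ℝ) (RatFunc ℝ) (P k))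
    (U := fun k => algebraMap (Polynomial ℝ) (RatFunc ℝ) (U k)) hc'
    (fun k => by simp only [hPrec, hC, map_add, map_mul])
    (fun k => by simp only [hUrec, hC, map_add, map_mul])
    (by simp [hU0]) (by simp [hU1]) n m N (by omega)
  have hΔ : C (q ^ 2 - a * p * q) * X ^ 2 + C (2 * q * r - a * p * r - b * p * q) * X
      + C (r ^ 2 - b * p * r - c * p ^ 2)
      = P 1 ^ 2 - (C a * X + C b) * P 0 * P 1 - C c * P 0 ^ 2 := by
    rw [hP0, hP1]
    simp only [map_sub, map_mul, map_pow, C_ofNat]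
    ring
  rw [hΔ]
  simp only [map_prod]
  rw [key]
  simp only [map_sub, map_mul, map_pow, ← hC]
  congr 1
  · congr 1
    · congr 3
      push_cast
      ring
    · rw [Nat.add_sub_cancel, ← Ico_add_one_right_eq_Icc, prod_Ico_eq_prod_range]
      refine prod_congr rfl fun e _ => ?_
      congr 1
      · push_cast
        congr 3 <;> ring_nf
      · omega
  · rw [Nat.add_sub_cancel, Nat.add_sub_add_right, ← Ico_add_one_right_eq_Icc,
      prod_Ico_eq_prod_range]
    refine prod_congr (by congr 1; omega) fun e _ => prod_congr rfl fun u _ => ?_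
    push_cast
    ring_nf
end

section
/- Let m ≥ 1 and let s, k, n be any integers. Let (F_n(x))_{n∈ℤ} be the sequence of Fibonacci polynomials. Then det( [ F_{s+k(n+i+j)}(x)^m ]_{0≤i,j≤m} ) = (−1)^{(s+kn+1)·C(m+1,2)} · ∏_{i=0}^{m} C(m,i) · F_{(i+1)k}(x)^{2(m−i)}, where C(·,·) are binomial coefficients; this is an identity of real polynomials. -/
open Polynomial Finset

/-- A product over pairs `i < j` of a function of `j - i`, collected by the value of `j - i`. -/
theorem prod_Ioi_sub_eq_prod_range_pow {M : Type*} [CommMonoid M] (g : ℤ → M) (m : ℕ) :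
    ∏ i : Fin (m + 1), ∏ j ∈ Finset.Ioi i, g ((j.1 : ℤ) - i.1)
      = ∏ i ∈ Finset.range (m + 1), g ((i : ℤ) + 1) ^ (m - i) := by
  induction m with
  | zero => simp
  | succ m ih =>
    rw [Fin.prod_univ_succ, Fin.prod_Ioi_zero]
    simp only [Fin.prod_Ioi_succ, Fin.val_succ, Fin.val_zero, Nat.cast_succ,
      add_sub_add_right_eq_sub]
    rw [ih, Fin.prod_univ_eq_prod_range (fun j => g ((j : ℤ) + 1 - (0 : ℕ))),
      ← Finset.prod_mul_distrib, Finset.prod_range_succ _ (m + 1)]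
    simp only [Nat.cast_zero, sub_zero, Nat.sub_self, pow_zero, mul_one]
    refine Finset.prod_congr rfl fun i hi => ?_
    rw [← pow_succ', Nat.succ_sub (by simpa [Nat.lt_succ_iff] using hi)]

theorem sum_range_sub_eq_choose_two (m : ℕ) :
    ∑ i ∈ Finset.range (m + 1), (m - i) = Nat.choose (m + 1) 2 := by
  rw [Nat.choose_two_right, ← Finset.sum_range_id]
  exact Finset.sum_range_reflect (fun i => i) (m + 1)

section FibonacciPolynomials

variable {F : ℤ → Polynomial ℝ}

/-- The addition formula for sequences with the Fibonacci polynomial recurrence. -/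
theorem fibonacci_polynomial_add (hF0 : F 0 = 0) (hF1 : F 1 = 1)
    (hFrec : ∀ n : ℤ, F (n + 2) = X * F (n + 1) + F n) (p q : ℤ) :
    F (p + q) = F p * F (q + 1) + F (p - 1) * F q := by
  suffices h : F (p + q) = F p * F (q + 1) + F (p - 1) * F q ∧
      F (p + (q + 1)) = F p * F (q + 2) + F (p - 1) * F (q + 1) from h.1
  induction q using Int.induction_on with
  | zero =>
    have h2 := hFrec 0
    have hp := hFrec (p - 1)
    norm_num [hF0, hF1] at h2
    rw [show p - 1 + 2 = p + 1 by ring, sub_add_cancel] at hp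
    norm_num [hF0, hF1, h2, hp]
    ring
  | succ q ih =>
    obtain ⟨h0, h1⟩ := ih
    have hp := hFrec (p + q)
    have hq := hFrec (q + 1)
    have hq' := hFrec q
    rw [show (q : ℤ) + 1 + 1 = q + 2 by ring] at *
    rw [show p + (q : ℤ) + 1 = p + (q + 1) by ring, show p + (q : ℤ) + 2 = p + (q + 2) by ring]
      at hp
    refine ⟨h1, ?_⟩
    rw [hp, h1, h0, hq]
    linear_combination -F (p - 1) * hq'
  | pred q ih =>
    obtain ⟨h0, h1⟩ := ih
    have hp := hFrec (p + (-q - 1))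
    have hq := hFrec (-q)
    have hq' := hFrec (-q - 1)
    rw [show p + (-(q : ℤ) - 1) + 2 = p + (-q + 1) by ring,
      show p + (-(q : ℤ) - 1) + 1 = p + -q by ring] at hp
    rw [show -(q : ℤ) - 1 + 2 = -q + 1 by ring, sub_add_cancel] at *
    refine ⟨?_, h0⟩
    linear_combination h1 - hp - X * h0 + F p * hq + F (p - 1) * hq'

/-- D'Ocagne's identity. -/
theorem fibonacci_polynomial_dOcagne (hF0 : F 0 = 0) (hF1 : F 1 = 1)
    (hFrec : ∀ n : ℤ, F (n + 2) = X * F (n + 1) + F n) (p d : ℤ) :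
    F (p + d) * F (p - 1) - F p * F (p + d - 1) = C ((-1 : ℝ) ^ p) * F d := by
  have step (p : ℤ) : F (p + 1 + d) * F p - F (p + 1) * F (p + d) =
      -(F (p + d) * F (p - 1) - F p * F (p + d - 1)) := by
    have h := hFrec (p - 1)
    have h' := hFrec (p + d - 1)
    rw [show p - 1 + 2 = p + 1 by ring, sub_add_cancel] at h
    rw [show p + d - 1 + 2 = p + 1 + d by ring, sub_add_cancel] at h'
    rw [h, h']
    ring
  induction p using Int.induction_on with
  | zero =>
    have h := hFrec (-1)
    norm_num [hF0, hF1] at h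
    simp [hF0, ← h]
  | succ p ih =>
    have h := step p
    rw [ih] at h
    rw [zpow_add_one₀ (by norm_num), show (p : ℤ) + 1 + d - 1 = p + d by ring, add_sub_cancel_right,
      h]
    simp
  | pred p ih =>
    have h := step (-p - 1)
    rw [sub_add_cancel, show -(p : ℤ) - 1 + d = -p + d - 1 by ring, ih] at h
    rw [zpow_sub_one₀ (by norm_num), show -(p : ℤ) - 1 + d = -p + d - 1 by ring, ← neg_inj, ← h]
    simp

end FibonacciPolynomials

/-- The determinant of the `m`-th powers of the values of a bilinear form on pairs of vectors in
the plane is a product of two homogeneous Vandermonde determinants. -/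
theorem det_bilinear_pow {R : Type*} [CommRing R] (m : ℕ) (a b c d : Fin (m + 1) → R) :
    Matrix.det (Matrix.of fun i j => (a i * c j + b i * d j) ^ m)
      = (∏ l ∈ Finset.range (m + 1), (Nat.choose m l : R)) *
        ∏ i, ∏ j ∈ Finset.Ioi i, (a j * b i - a i * b j) * (c j * d i - c i * d j) := by
  have hfac : (Matrix.of fun i j => (a i * c j + b i * d j) ^ m) =
      Matrix.projVandermonde a b *
        Matrix.diagonal (fun l : Fin (m + 1) => (Nat.choose m l.1 : R)) *
        (Matrix.projVandermonde c d).transpose := by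
    ext i j : 2
    rw [Matrix.mul_apply, Matrix.of_apply, add_pow, ← Fin.sum_univ_eq_sum_range
      (fun l => (a i * c j) ^ l * (b i * d j) ^ (m - l) * (Nat.choose m l : R))]
    refine Finset.sum_congr rfl fun l _ => ?_
    rw [Matrix.mul_diagonal, Matrix.transpose_apply, Matrix.projVandermonde_apply,
      Matrix.projVandermonde_apply, Fin.val_rev, Nat.add_sub_add_right]
    ring
  rw [hfac, Matrix.det_mul, Matrix.det_mul, Matrix.det_transpose, Matrix.det_diagonal,
    Matrix.det_projVandermonde, Matrix.det_projVandermonde,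
    Fin.prod_univ_eq_prod_range (fun l => (Nat.choose m l : R))]
  simp only [Finset.prod_mul_distrib]
  ring

/-- **Corollary 2, first identity.** For the Fibonacci polynomials `(F_n(x))_{n∈ℤ}`,
`det([F_{s+k(n+i+j)}(x)^m]) = (−1)^{(s+kn+1)·C(m+1,2)} · ∏_{i=0}^m C(m,i)·F_{(i+1)k}(x)^{2(m−i)}`. -/
theorem det_power_matrix_fibonacci_polynomials
    (m : ℕ) (hm : 1 ≤ m) (s k n : ℤ)
    (F : ℤ → Polynomial ℝ)
    (hF0 : F 0 = 0) (hF1 : F 1 = 1)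
    (hFrec : ∀ n : ℤ, F (n + 2) = X * F (n + 1) + F n) :
    Matrix.det (Matrix.of fun i j : Fin (m + 1) =>
        (F (s + k * (n + i.1 + j.1))) ^ m)
      = Polynomial.C ((-1 : ℝ) ^ ((s + k * n + 1) * (Nat.choose (m + 1) 2 : ℤ)))
        * ∏ i ∈ Finset.range (m + 1),
            ((Nat.choose m i : Polynomial ℝ) * (F (((i : ℤ) + 1) * k)) ^ (2 * (m - i))) := by
  have hentry (i j : Fin (m + 1)) : F (s + k * (n + i.1 + j.1)) =
      F (s + k * n + i.1 * k) * F (j.1 * k + 1) + F (s + k * n + i.1 * k - 1) * F (j.1 * k) := by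
    rw [← fibonacci_polynomial_add hF0 hF1 hFrec]
    congr 1
    ring
  have hminor (i j : Fin (m + 1)) :
      (F (s + k * n + j.1 * k) * F (s + k * n + i.1 * k - 1)
          - F (s + k * n + i.1 * k) * F (s + k * n + j.1 * k - 1)) *
        (F (j.1 * k + 1) * F (i.1 * k) - F (i.1 * k + 1) * F (j.1 * k)) =
      C ((-1 : ℝ) ^ (s + k * n + 1)) * F (((j.1 : ℤ) - i.1) * k) ^ 2 := by
    have h := fibonacci_polynomial_dOcagne hF0 hF1 hFrec (s + k * n + i.1 * k)
      (((j.1 : ℤ) - i.1) * k)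
    have h' := fibonacci_polynomial_dOcagne hF0 hF1 hFrec (i.1 * k + 1) (((j.1 : ℤ) - i.1) * k)
    rw [show s + k * n + i.1 * k + ((j.1 : ℤ) - i.1) * k = s + k * n + j.1 * k by ring] at h
    rw [show i.1 * k + 1 + ((j.1 : ℤ) - i.1) * k = j.1 * k + 1 by ring, add_sub_cancel_right,
      add_sub_cancel_right] at h'
    have hsign : (-1 : ℝ) ^ (s + k * n + i.1 * k) * (-1) ^ (i.1 * k + 1) =
        (-1) ^ (s + k * n + 1) := by
      rw [← zpow_add₀ (by norm_num), show s + k * n + i.1 * k + (i.1 * k + 1) =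
        s + k * n + 1 + (i.1 * k + i.1 * k) by ring, zpow_add₀ (by norm_num),
        (Even.add_self (i.1 * k)).neg_one_zpow, mul_one]
    rw [h, h', ← hsign, C_mul]
    ring
  simp only [hentry]
  rw [det_bilinear_pow m (fun i => F (s + k * n + i.1 * k)) (fun i => F (s + k * n + i.1 * k - 1))
    (fun j => F (j.1 * k + 1)) (fun j => F (j.1 * k))]
  simp only [hminor]
  rw [prod_Ioi_sub_eq_prod_range_pow (fun d => C ((-1 : ℝ) ^ (s + k * n + 1)) * F (d * k) ^ 2)]
  simp only [mul_pow, Finset.prod_mul_distrib, Finset.prod_pow_eq_pow_sum,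
    sum_range_sub_eq_choose_two, ← pow_mul]
  rw [zpow_mul, zpow_natCast, C_pow]
  ring
end

section
/- Let m ≥ 1 and let s, k, n be any integers. Let (F_n(x))_{n∈ℤ} be the sequence of Fibonacci polynomials, and assume F_{s+k(n+i+j)}(x) is a nonzero polynomial for every 0 ≤ i, j ≤ m. Then, in the field of rational functions ℝ(x), det( [ 1 / F_{s+k(n+i+j)}(x) ]_{0≤i,j≤m} ) = ( (−1)^{(s+kn)·C(m+1,2)} · ∏_{i=0}^{m} F_{k(i+1)}(x)^{2(m−i)} ) / ( ∏_{0≤i,j≤m} F_{s+k(n+i+j)}(x) ), where C(·,·) are binomial coefficients. -/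
open Polynomial Finset

section FibonacciSequence

variable {K : Type*} [Field K] {x : K} {G : ℤ → K}

/-- The addition formula for a Fibonacci-type sequence indexed by `ℤ`. -/
theorem fibonacci_add (h0 : G 0 = 0) (h1 : G 1 = 1)
    (hrec : ∀ n : ℤ, G (n + 2) = x * G (n + 1) + G n) (a b : ℤ) :
    G (a + b) = G a * G (b + 1) + G (a + 1) * G b - x * (G a * G b) := by
  suffices h : (G (a + b) = G a * G (b + 1) + G (a + 1) * G b - x * (G a * G b)) ∧
      G (a + (b + 1)) = G a * G (b + 1 + 1) + G (a + 1) * G (b + 1) - x * (G a * G (b + 1)) from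
    h.1
  induction b using Int.induction_on with
  | zero =>
    have h2 := hrec 0
    norm_num at h2
    norm_num [h0, h1, h2]
    ring
  | succ b ih =>
    obtain ⟨ih₀, ih₁⟩ := ih
    refine ⟨ih₁, ?_⟩
    have e₁ := hrec (a + b)
    have e₂ := hrec b
    have e₃ := hrec (b + 1)
    ring_nf at *
    rw [e₁, ih₀, ih₁, e₃, e₂]
    ring
  | pred b ih =>
    obtain ⟨ih₀, ih₁⟩ := ih
    have e₁ := hrec (a + (-b - 1))
    have e₂ := hrec (-b - 1)
    have e₃ := hrec (-b)
    rw [show a + (-(b : ℤ) - 1) + 2 = a + (-b + 1) by ring,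
      show a + (-(b : ℤ) - 1) + 1 = a + -b by ring] at e₁
    rw [show -(b : ℤ) - 1 + 2 = -b + 1 by ring, show -(b : ℤ) - 1 + 1 = -b by ring] at e₂
    rw [show -(b : ℤ) + 2 = -b + 1 + 1 by ring] at e₃
    rw [show -(b : ℤ) - 1 + 1 = -b by ring]
    refine ⟨?_, ih₀⟩
    linear_combination ih₁ - e₁ - x * ih₀ + G a * e₃ + (G (a + 1) - x * G a) * e₂

/-- Cassini's identity for a Fibonacci-type sequence indexed by `ℤ`. -/
theorem fibonacci_cassini (h0 : G 0 = 0) (h1 : G 1 = 1)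
    (hrec : ∀ n : ℤ, G (n + 2) = x * G (n + 1) + G n) (a : ℤ) :
    G (a + 1) ^ 2 - x * (G (a + 1) * G a) - G a ^ 2 = (-1) ^ a := by
  induction a using Int.induction_on with
  | zero => simp [h0, h1]
  | succ a ih =>
    have e := hrec a
    rw [show (a : ℤ) + 2 = a + 1 + 1 by ring] at e
    rw [zpow_add_one₀ (by norm_num), ← ih, e]
    ring
  | pred a ih =>
    have e := hrec (-a - 1)
    rw [show -(a : ℤ) - 1 + 2 = -a + 1 by ring, show -(a : ℤ) - 1 + 1 = -a by ring] at e
    rw [zpow_sub_one₀ (by norm_num), ← ih, e, show -(a : ℤ) - 1 + 1 = -a by ring, inv_neg_one]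
    ring

/-- Vajda's identity for a Fibonacci-type sequence indexed by `ℤ`. -/
theorem fibonacci_vajda (h0 : G 0 = 0) (h1 : G 1 = 1)
    (hrec : ∀ n : ℤ, G (n + 2) = x * G (n + 1) + G n) (a i j : ℤ) :
    G (a + i) * G (a + j) - G a * G (a + i + j) = (-1) ^ a * (G i * G j) := by
  have hij := fibonacci_add h0 h1 hrec i j
  have hij' := fibonacci_add h0 h1 hrec (i + 1) j
  have ei := hrec i
  rw [show i + 2 = i + 1 + 1 by ring] at ei
  rw [show i + 1 + j = i + j + 1 by ring, ei] at hij'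
  rw [← fibonacci_cassini h0 h1 hrec a, add_assoc a i j, fibonacci_add h0 h1 hrec a i,
    fibonacci_add h0 h1 hrec a j, fibonacci_add h0 h1 hrec a (i + j), hij, hij']
  ring

end FibonacciSequence

/-- One step of Gaussian elimination, with the top left entry as pivot. -/
theorem Matrix.det_eq_mul_det_schur_zero {K : Type*} [Field K] {n : ℕ}
    (A : Matrix (Fin (n + 1)) (Fin (n + 1)) K) (h : A 0 0 ≠ 0) :
    A.det = A 0 0 *
      (Matrix.of fun i j : Fin n => A i.succ j.succ - A i.succ 0 * A 0 j.succ / A 0 0).det := by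
  let c : Fin (n + 1) → K := Fin.cons 0 fun i => A i.succ 0 / A 0 0
  let B : Matrix (Fin (n + 1)) (Fin (n + 1)) K := Matrix.of fun i j => A i j - c i * A 0 j
  have hB : A.det = B.det :=
    Matrix.det_eq_of_forall_row_eq_smul_add_const c 0 rfl fun i j => by simp [B, c]
  have hB₀ (i : Fin n) : B i.succ 0 = 0 := by simp [B, c, h]
  rw [hB, Matrix.det_succ_column_zero, Fin.sum_univ_succ]
  simp only [hB₀, mul_zero, zero_mul, sum_const_zero, add_zero]
  congr 1
  · simp [B, c]
  · congr 1
    ext i j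
    simp [B, c]
    ring

/-- The determinant of a reciprocal Hankel matrix built on an arithmetic progression
in a sequence satisfying Vajda's identity. -/
theorem det_reciprocal_hankel_of_vajda {K : Type*} [Field K] {G : ℤ → K}
    (hG : ∀ a i j : ℤ, G (a + i) * G (a + j) - G a * G (a + i + j) = (-1) ^ a * (G i * G j))
    (k : ℤ) (m : ℕ) (r : ℤ)
    (hne : ∀ i ∈ range (m + 1), ∀ j ∈ range (m + 1), G (r + k * (i + j)) ≠ 0) :
    Matrix.det (Matrix.of fun i j : Fin (m + 1) => (G (r + k * (i.1 + j.1)))⁻¹)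
      = ((-1) ^ (r * ((m + 1).choose 2 : ℤ))
          * ∏ i ∈ range (m + 1), G (k * ((i : ℤ) + 1)) ^ (2 * (m - i)))
        / ∏ i ∈ range (m + 1), ∏ j ∈ range (m + 1), G (r + k * (i + j)) := by
  induction m generalizing r with
  | zero => simp
  | succ m ih =>
    have shift (i j : ℕ) : r + k * (((i + 1 : ℕ) : ℤ) + ((j + 1 : ℕ) : ℤ))
        = r + 2 * k + k * (i + j) := by push_cast; ring
    have hne' : ∀ i ∈ range (m + 1), ∀ j ∈ range (m + 1), G (r + 2 * k + k * (i + j)) ≠ 0 := by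
      intro i hi j hj
      rw [← shift]
      exact hne _ (by simpa using hi) _ (by simpa using hj)
    have hr : G r ≠ 0 := by simpa using hne 0 (by simp) 0 (by simp)
    have hcol (i : ℕ) (hi : i ∈ range (m + 1)) : G (r + k * (i + 1)) ≠ 0 := by
      simpa using hne (i + 1) (by simpa using hi) 0 (by simp)
    let v : Fin (m + 1) → K := fun i => G (k * (i.1 + 1)) / G (r + k * (i.1 + 1))
    have hschur : (Matrix.of fun i j : Fin (m + 1) =>
        (G (r + k * ((i.succ : Fin (m + 2)).1 + (j.succ : Fin (m + 2)).1)))⁻¹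
          - (G (r + k * ((i.succ : Fin (m + 2)).1 + (0 : Fin (m + 2)).1)))⁻¹
            * (G (r + k * ((0 : Fin (m + 2)).1 + (j.succ : Fin (m + 2)).1)))⁻¹
              / (G (r + k * ((0 : Fin (m + 2)).1 + (0 : Fin (m + 2)).1)))⁻¹)
        = Matrix.of fun i j => ((-1) ^ r * v i) * (Matrix.of fun i j =>
            v j * (Matrix.of fun i j : Fin (m + 1) =>
              (G (r + 2 * k + k * (i.1 + j.1)))⁻¹) i j) i j := by
      ext i j
      have hi := hcol i (mem_range.2 i.2)
      have hj := hcol j (mem_range.2 j.2)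
      have hij := hne' i (mem_range.2 i.2) j (mem_range.2 j.2)
      have key := hG r (k * (i.1 + 1)) (k * (j.1 + 1))
      rw [show r + k * ((i.1 : ℤ) + 1) + k * (j.1 + 1) = r + 2 * k + k * (i.1 + j.1) by ring] at key
      simp only [Matrix.of_apply, Fin.val_succ, shift, v]
      simp only [Fin.val_zero, Nat.cast_add, Nat.cast_one, Nat.cast_zero, add_zero, zero_add,
        mul_zero]
      field_simp
      linear_combination key
    rw [Matrix.det_eq_mul_det_schur_zero _ (by simpa using hr)]
    simp only [Matrix.of_apply]
    rw [hschur, Matrix.det_mul_column, Matrix.det_mul_row, ih _ hne']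
    have hsign : ((-1 : K) ^ (r * ((m + 1 + 1).choose 2 : ℤ)))
        = ((-1) ^ r) ^ (m + 1) * (-1) ^ ((r + 2 * k) * ((m + 1).choose 2 : ℤ)) := by
      have h1 : (-1 : K) ≠ 0 := by norm_num
      rw [← zpow_natCast, ← zpow_mul, ← zpow_add₀ h1, Nat.choose_succ_succ' (m + 1) 1,
        Nat.choose_one_right,
        show r * ((m + 1 : ℕ) : ℤ) + (r + 2 * k) * ((m + 1).choose (1 + 1) : ℤ)
          = r * ((m + 1 + (m + 1).choose (1 + 1) : ℕ) : ℤ) + 2 * (k * (m + 1).choose (1 + 1)) by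
          push_cast; ring, zpow_add₀ h1, zpow_mul _ 2]
      simp
    have hnum : ∏ i ∈ range (m + 1 + 1), G (k * ((i : ℤ) + 1)) ^ (2 * (m + 1 - i))
        = (∏ i ∈ range (m + 1), G (k * ((i : ℤ) + 1)) ^ (2 * (m - i)))
          * (∏ i ∈ range (m + 1), G (k * ((i : ℤ) + 1))) ^ 2 := by
      rw [prod_range_succ, ← prod_pow, ← prod_mul_distrib]
      simp only [Nat.sub_self, mul_zero, pow_zero, mul_one]
      refine prod_congr rfl fun i hi => ?_
      rw [← pow_add]
      congr 1
      have := mem_range.1 hi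
      omega
    have hden : ∏ i ∈ range (m + 1 + 1), ∏ j ∈ range (m + 1 + 1), G (r + k * (i + j))
        = G r * (∏ i ∈ range (m + 1), G (r + k * (i + 1))) ^ 2
          * ∏ i ∈ range (m + 1), ∏ j ∈ range (m + 1), G (r + 2 * k + k * (i + j)) := by
      simp only [prod_range_succ' _ (m + 1), prod_mul_distrib, shift]
      simp only [Nat.cast_add, Nat.cast_one, Nat.cast_zero, add_zero, zero_add, mul_zero]
      ring
    have hv : ∏ i, v i = (∏ i ∈ range (m + 1), G (k * (i + 1)))
        / ∏ i ∈ range (m + 1), G (r + k * (i + 1)) := by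
      rw [← prod_div_distrib, prod_range]
    have hc : ∏ i ∈ range (m + 1), G (r + k * (i + 1)) ≠ 0 := prod_ne_zero_iff.2 hcol
    have hd : ∏ i ∈ range (m + 1), ∏ j ∈ range (m + 1), G (r + 2 * k + k * (i + j)) ≠ 0 :=
      prod_ne_zero_iff.2 fun i hi => prod_ne_zero_iff.2 (hne' i hi)
    rw [hsign, hnum, hden, prod_mul_distrib, hv]
    simp only [prod_const, card_univ, Fintype.card_fin, Fin.val_zero, Nat.cast_zero, add_zero,
      mul_zero]
    field_simp

/-- **Corollary 2, third identity.** For the Fibonacci polynomials `(F_n(x))_{n∈ℤ}`,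
if every `F_{s+k(n+i+j)}(x)` (`0 ≤ i,j ≤ m`) is a nonzero polynomial, then in `ℝ(x)`:
`det([1/F_{s+k(n+i+j)}(x)]) = (−1)^{(s+kn)·C(m+1,2)} ∏_{i=0}^m F_{k(i+1)}(x)^{2(m−i)}
  / ∏_{0≤i,j≤m} F_{s+k(n+i+j)}(x)`. -/
theorem det_reciprocal_matrix_fibonacci_polynomials
    (m : ℕ) (hm : 1 ≤ m) (s k n : ℤ)
    (F : ℤ → Polynomial ℝ)
    (hF0 : F 0 = 0) (hF1 : F 1 = 1)
    (hFrec : ∀ n : ℤ, F (n + 2) = X * F (n + 1) + F n)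
    (hne : ∀ i j : Fin (m + 1), F (s + k * (n + i.1 + j.1)) ≠ 0) :
    Matrix.det (Matrix.of fun i j : Fin (m + 1) =>
        (algebraMap (Polynomial ℝ) (RatFunc ℝ) (F (s + k * (n + i.1 + j.1))))⁻¹)
      = ((-1 : RatFunc ℝ) ^ ((s + k * n) * (Nat.choose (m + 1) 2 : ℤ))
          * ∏ i ∈ Finset.range (m + 1),
              (algebraMap (Polynomial ℝ) (RatFunc ℝ) (F (k * ((i : ℤ) + 1))))
                ^ (2 * (m - i)))
        / ∏ i ∈ Finset.range (m + 1), ∏ j ∈ Finset.range (m + 1),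
            algebraMap (Polynomial ℝ) (RatFunc ℝ) (F (s + k * (n + i + j))) := by
  have hinj : Function.Injective (algebraMap (Polynomial ℝ) (RatFunc ℝ)) :=
    RatFunc.algebraMap_injective ℝ
  have hG := fibonacci_vajda (G := fun a => algebraMap (Polynomial ℝ) (RatFunc ℝ) (F a))
    (x := algebraMap (Polynomial ℝ) (RatFunc ℝ) X) (by simp [hF0]) (by simp [hF1])
    (fun a => by simp only [hFrec, map_add, map_mul])
  have shift (i j : ℕ) : s + k * (n + i + j) = s + k * n + k * (i + j) := by ring
  simp only [shift] at hne ⊢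
  refine det_reciprocal_hankel_of_vajda
    (G := fun a => algebraMap (Polynomial ℝ) (RatFunc ℝ) (F a)) hG k m (s + k * n)
    fun i hi j hj => ?_
  exact (map_ne_zero_iff _ hinj).2 (hne ⟨i, mem_range.1 hi⟩ ⟨j, mem_range.1 hj⟩)
end

section
/- Let n be any integer, m ≥ 1, and 1 ≤ d ≤ m+1. Let (F_n(x))_{n∈ℤ} be the sequence of Fibonacci polynomials. Then the determinant of the d×d matrix with (i,j) entry F_{n+i+j}(x)^{⟨m⟩} (indices 0 ≤ i, j ≤ d−1) equals (−1)^{n·C(d,2) + C(d+1,3)} · ∏_{i=1}^{d−1} ( F_i(x) · F_{m+1−i}(x) )^{d−i} · ∏_{i=d−1}^{2(d−1)} F_{n+i}(x)^{⟨m+1−d⟩}, where C(·,·) are binomial coefficients; this is an identity of real polynomials. -/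
open Polynomial Finset

section LinearRecurrence

variable {R : Type*} [CommRing R] {x : R} {F : ℤ → R}

lemma eq_zero_of_second_order_recurrence {G : ℤ → R} (h0 : G 0 = 0) (h1 : G 1 = 0)
    (hG : ∀ n, G (n + 2) = x * G (n + 1) + G n) (n : ℤ) : G n = 0 := by
  have key : ∀ n : ℤ, G n = 0 ∧ G (n + 1) = 0 := by
    intro n
    induction n with
    | zero => exact ⟨h0, by simpa using h1⟩
    | succ n ih =>
      refine ⟨ih.2, ?_⟩
      have h := hG n
      rw [ih.1, ih.2] at h
      rw [show (n : ℤ) + 1 + 1 = n + 2 by ring, h]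
      ring
    | pred n ih =>
      have h := hG (-n - 1)
      rw [show -(n : ℤ) - 1 + 2 = -n + 1 by ring, show -(n : ℤ) - 1 + 1 = -n by ring,
        ih.1, ih.2] at h
      refine ⟨by linear_combination -h, ?_⟩
      rw [show -(n : ℤ) - 1 + 1 = -n by ring, ih.1]
  exact (key n).1

lemma fib_add (hF0 : F 0 = 0) (hF1 : F 1 = 1)
    (hFrec : ∀ n, F (n + 2) = x * F (n + 1) + F n) (k c : ℤ) :
    F (k + c) = F c * F (k + 1) + F (c - 1) * F k := by
  have hm1 : F (-1) = 1 := by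
    have h := hFrec (-1)
    norm_num at h
    rw [hF0, hF1] at h
    linear_combination -h
  rw [← sub_eq_zero]
  refine eq_zero_of_second_order_recurrence (x := x)
    (G := fun c => F (k + c) - (F c * F (k + 1) + F (c - 1) * F k)) ?_ ?_ (fun c => ?_) c
  · simp [hF0, hm1]
  · simp [hF0, hF1]
  · have h1 := hFrec (k + c)
    have h2 := hFrec c
    have h3 := hFrec (c - 1)
    rw [show c - 1 + 2 = c + 1 by ring, show c - 1 + 1 = c by ring] at h3
    simp only [show k + (c + 2) = k + c + 2 by ring, show k + (c + 1) = k + c + 1 by ring,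
      show c + 2 - 1 = c + 1 by ring, show c + 1 - 1 = c by ring]
    linear_combination h1 - F (k + 1) * h2 - F k * h3

lemma fib_dOcagne (hF0 : F 0 = 0) (hF1 : F 1 = 1)
    (hFrec : ∀ n, F (n + 2) = x * F (n + 1) + F n) (s : ℕ) (m : ℤ) :
    F (s + 1) * F m = F s * F (m + 1) + (-1) ^ s * F (m - s) := by
  induction s generalizing m with
  | zero => simp [hF0, hF1]
  | succ s ih =>
    have h := ih (m - 1)
    have h1 := hFrec s
    have h2 := hFrec (m - 1)
    push_cast
    rw [show m - 1 + 2 = m + 1 by ring, sub_add_cancel] at h2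
    rw [sub_add_cancel, show m - 1 - s = m - (s + 1) by ring] at h
    rw [show (s : ℤ) + 1 + 1 = s + 2 by ring, pow_succ]
    linear_combination F m * h1 - F (s + 1) * h2 - h

lemma fib_vajda (hF0 : F 0 = 0) (hF1 : F 1 = 1)
    (hFrec : ∀ n, F (n + 2) = x * F (n + 1) + F n) (s : ℕ) (m k : ℤ) :
    F (k + s) * F m = F s * F (k + m) + (-1) ^ s * F (m - s) * F k := by
  rw [← sub_eq_zero]
  refine eq_zero_of_second_order_recurrence (x := x)
    (G := fun k => F (k + s) * F m - (F s * F (k + m) + (-1) ^ s * F (m - s) * F k))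
    ?_ ?_ (fun k => ?_) k
  · simp [hF0]
  · have h := fib_dOcagne hF0 hF1 hFrec s m
    simp only [hF1, add_comm (1 : ℤ)]
    linear_combination h
  · have h1 := hFrec (k + s)
    have h2 := hFrec (k + m)
    have h3 := hFrec k
    simp only [show k + 2 + s = k + s + 2 by ring, show k + 1 + s = k + s + 1 by ring,
      show k + 2 + m = k + m + 2 by ring, show k + 1 + m = k + m + 1 by ring]
    linear_combination F m * h1 - F s * h2 - (-1) ^ s * F (m - s) * h3

end LinearRecurrence

lemma exists_prod_linear_forms_eq_sum {R : Type*} [CommRing R] (c e : ℕ → R) (m : ℕ) :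
    ∃ k : ℕ → R, ∀ a b : R, ∏ u ∈ range m, (c u * a + e u * b)
      = ∑ p ∈ range (m + 1), a ^ p * b ^ (m - p) * k p := by
  classical
  refine ⟨fun p => ∑ t ∈ powersetCard p (range m), (∏ u ∈ t, c u) * ∏ u ∈ range m \ t, e u,
    fun a b => ?_⟩
  rw [prod_add, sum_powerset, card_range]
  refine sum_congr rfl fun p _ => ?_
  rw [mul_sum]
  refine sum_congr rfl fun t ht => ?_
  obtain ⟨hts, hcard⟩ := mem_powersetCard.mp ht
  rw [prod_mul_distrib, prod_mul_distrib, prod_const, prod_const, hcard,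
    card_sdiff_of_subset hts, hcard, card_range]
  ring

lemma sum_card_Ioi_fin (d : ℕ) : ∑ i : Fin d, #(Ioi i) = d.choose 2 := by
  simp only [Fin.card_Ioi]
  rw [Fin.sum_univ_eq_sum_range (fun i => d - 1 - i) d, sum_range_reflect (fun i => i) d,
    sum_range_id, Nat.choose_two_right]

lemma prod_prod_Ioi_neg {R : Type*} [CommRing R] {d : ℕ} (f : Fin d → Fin d → R) :
    ∏ i, ∏ j ∈ Ioi i, -f i j = (-1) ^ d.choose 2 * ∏ i, ∏ j ∈ Ioi i, f i j := by
  simp only [prod_neg, prod_mul_distrib, prod_pow_eq_pow_sum, sum_card_Ioi_fin]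

lemma sign_revPerm (d : ℕ) : Equiv.Perm.sign (Fin.revPerm : Equiv.Perm (Fin d))
    = (-1) ^ d.choose 2 := by
  rw [Equiv.Perm.sign_eq_prod_prod_Ioi, ← sum_card_Ioi_fin, ← prod_pow_eq_pow_sum]
  refine prod_congr rfl fun i _ => ?_
  rw [← prod_const]
  refine prod_congr rfl fun j hj => ?_
  have := mem_Ioi.mp hj
  simp [this.le]

/-- The Hankel matrix of rising powers `F_{n+i+j}^{⟨m⟩}`. -/
def risingPowerMatrix {R : Type*} [CommRing R] (F : ℤ → R) (n : ℤ) (m d : ℕ) :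
    Matrix (Fin d) (Fin d) R :=
  Matrix.of fun i j => ∏ u ∈ range m, F (n + i.1 + j.1 + u)

section Determinant

variable {R : Type*} [CommRing R] {x : R} {F : ℤ → R}

lemma exists_risingPowerMatrix_eq_projVandermonde_mul (hF0 : F 0 = 0) (hF1 : F 1 = 1)
    (hFrec : ∀ n, F (n + 2) = x * F (n + 1) + F n) (m : ℕ) :
    ∃ K : Matrix (Fin (m + 1)) (Fin (m + 1)) R, ∀ n : ℤ, risingPowerMatrix F n m (m + 1)
      = Matrix.projVandermonde (fun i : Fin (m + 1) => F (n + i.1 + 1))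
          (fun i => F (n + i.1)) * K := by
  choose k hk using fun j : Fin (m + 1) =>
    exists_prod_linear_forms_eq_sum (fun u => F (j.1 + u)) (fun u => F (j.1 + u - 1)) m
  refine ⟨Matrix.of fun p j => k j p, fun n => ?_⟩
  ext i j
  rw [Matrix.mul_apply]
  simp only [risingPowerMatrix, Matrix.of_apply, Matrix.projVandermonde_apply, Fin.val_rev]
  have h : ∀ u : ℕ, F (n + i.1 + j.1 + u)
      = F (j.1 + u) * F (n + i.1 + 1) + F (j.1 + u - 1) * F (n + i.1) := fun u => by
    rw [add_assoc (n + (i.1 : ℤ)), fib_add hF0 hF1 hFrec]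
  simp only [h, hk, Nat.add_sub_add_right]
  rw [Fin.sum_univ_eq_sum_range
    (fun p => F (n + i.1 + 1) ^ p * F (n + i.1) ^ (m - p) * k j p) (m + 1)]

lemma det_risingPowerMatrix_succ_left (hF0 : F 0 = 0) (hF1 : F 1 = 1)
    (hFrec : ∀ n, F (n + 2) = x * F (n + 1) + F n) (n : ℤ) (m : ℕ) :
    (risingPowerMatrix F (n + 1) m (m + 1)).det
      = (-1) ^ (m + 1).choose 2 * (risingPowerMatrix F n m (m + 1)).det := by
  obtain ⟨K, hK⟩ := exists_risingPowerMatrix_eq_projVandermonde_mul hF0 hF1 hFrec m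
  rw [hK, hK, Matrix.det_mul, Matrix.det_mul, Matrix.det_projVandermonde,
    Matrix.det_projVandermonde, ← mul_assoc, ← prod_prod_Ioi_neg]
  congr 1
  refine prod_congr rfl fun i _ => prod_congr rfl fun j _ => ?_
  have h1 := hFrec (n + i.1)
  have h2 := hFrec (n + j.1)
  simp only [show ∀ k : ℤ, n + 1 + k = n + k + 1 from fun k => by ring,
    show ∀ k : ℤ, n + k + 1 + 1 = n + k + 2 from fun k => by ring]
  linear_combination F (n + i.1 + 1) * h2 - F (n + j.1 + 1) * h1

lemma units_neg_one_zpow_congr {a b : ℤ} (h : Even (a - b)) :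
    (-1 : Rˣ) ^ a = (-1) ^ b := by
  rw [← sub_add_cancel a b, zpow_add, h.neg_one_zpow, one_mul]

lemma det_risingPowerMatrix_eq_zpow_mul (hF0 : F 0 = 0) (hF1 : F 1 = 1)
    (hFrec : ∀ n, F (n + 2) = x * F (n + 1) + F n) (n₀ k : ℤ) (m : ℕ) :
    (risingPowerMatrix F (n₀ + k) m (m + 1)).det
      = (((-1 : Rˣ) ^ (k * (m + 1).choose 2) : Rˣ) : R)
        * (risingPowerMatrix F n₀ m (m + 1)).det := by
  have step (k : ℤ) : (((-1 : Rˣ) ^ ((k + 1) * (m + 1).choose 2) : Rˣ) : R)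
      = (-1) ^ (m + 1).choose 2 * (((-1 : Rˣ) ^ (k * (m + 1).choose 2) : Rˣ) : R) := by
    rw [add_mul, one_mul, zpow_add, zpow_natCast, mul_comm]
    simp
  induction k with
  | zero => simp
  | succ k ih =>
    rw [← add_assoc, det_risingPowerMatrix_succ_left hF0 hF1 hFrec, ih, step, mul_assoc]
  | pred k ih =>
    have h := det_risingPowerMatrix_succ_left hF0 hF1 hFrec (n₀ + (-k - 1)) m
    have hs := step (-k - 1)
    rw [sub_add_cancel] at hs
    rw [show n₀ + (-(k : ℤ) - 1) + 1 = n₀ + -k by ring, ih, hs, mul_assoc] at h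
    have hu : IsUnit ((-1 : R) ^ (m + 1).choose 2) := isUnit_one.neg.pow _
    exact (hu.mul_left_cancel h).symm

lemma det_risingPowerMatrix_one_sub (hF0 : F 0 = 0) (m : ℕ) :
    (risingPowerMatrix F (1 - m) m (m + 1)).det
      = (-1) ^ (m + 1).choose 2 * (∏ u ∈ range m, F (u + 1)) ^ (m + 1) := by
  have hdet := Matrix.det_permute' (Fin.revPerm : Equiv.Perm (Fin (m + 1)))
    (risingPowerMatrix F (1 - m) m (m + 1))
  have htri : ((risingPowerMatrix F (1 - m) m (m + 1)).submatrix id Fin.revPerm).det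
      = (∏ u ∈ range m, F (u + 1)) ^ (m + 1) := by
    rw [Matrix.det_of_isLowerTriangular]
    · rw [← Fin.prod_const]
      refine prod_congr rfl fun i _ => ?_
      simp only [Matrix.submatrix_apply, risingPowerMatrix, Matrix.of_apply]
      refine prod_congr rfl fun u _ => ?_
      simp only [id, Fin.revPerm_apply, Fin.val_rev]
      congr 1
      have := i.2
      omega
    · intro i j hij
      have hij : i < j := hij
      have := i.2
      have := j.2
      have hlt : i.1 < j.1 := hij
      refine prod_eq_zero (i := j.1 - i.1 - 1) (mem_range.mpr (by omega)) ?_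
      rw [← hF0]
      simp only [id, Fin.revPerm_apply, Fin.val_rev]
      congr 1
      omega
  rw [htri, sign_revPerm] at hdet
  rw [hdet, ← mul_assoc]
  push_cast
  rw [← mul_pow]
  simp

lemma det_risingPowerMatrix_succ_power (hF0 : F 0 = 0) (hF1 : F 1 = 1)
    (hFrec : ∀ n, F (n + 2) = x * F (n + 1) + F n) (n : ℤ) (m e : ℕ) :
    (risingPowerMatrix F n (m + 1) (e + 1)).det
        * ∏ j ∈ range (e + 1), ((-1) ^ j * F (m + 1 - j))
      = F (m + 1) ^ (e + 1) * (∏ i ∈ range (e + 1), F (n + e + i))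
        * (risingPowerMatrix F (n + 1) m (e + 1)).det := by
  let T : Matrix (Fin (e + 1)) (Fin (e + 1)) R := Matrix.of fun p j =>
    (if j.1 = p.1 then (-1) ^ (e - j.1) * F (m + 1 - (e - j.1 : ℕ)) else 0)
      + if j.1 + 1 = p.1 then F (e - j.1 : ℕ) else 0
  have hT : T.det = ∏ j ∈ range (e + 1), ((-1) ^ j * F (m + 1 - j)) := by
    rw [Matrix.det_of_isLowerTriangular]
    · rw [← prod_range_reflect,
        ← Fin.prod_univ_eq_prod_range
          (fun j => (-1) ^ (e + 1 - 1 - j) * F (m + 1 - (e + 1 - 1 - j : ℕ)))]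
      exact prod_congr rfl fun j _ => by simp [T]
    · intro p j hpj
      have hpj : p.1 < j.1 := hpj
      simp only [T, Matrix.of_apply]
      rw [if_neg (by omega), if_neg (by omega), add_zero]
  have hmul : risingPowerMatrix F n (m + 1) (e + 1) * T
      = Matrix.of fun i j => (F (m + 1) * F (n + e + i.1))
          * risingPowerMatrix F (n + 1) m (e + 1) i j := by
    ext i j
    rw [Matrix.mul_apply]
    simp only [risingPowerMatrix, Matrix.of_apply, T]
    rw [Fin.sum_univ_eq_sum_range (fun p => (∏ u ∈ range (m + 1), F (n + i.1 + p + u)) *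
      ((if j.1 = p then (-1) ^ (e - j.1) * F (m + 1 - (e - j.1 : ℕ)) else 0)
        + if j.1 + 1 = p then F (e - j.1 : ℕ) else 0))]
    simp only [mul_add, sum_add_distrib, mul_ite, mul_zero, sum_ite_eq]
    have hlast : (if j.1 + 1 ∈ range (e + 1) then
        (∏ u ∈ range (m + 1), F (n + i.1 + (j.1 + 1 : ℕ) + u)) * F (e - j.1 : ℕ) else 0)
        = (∏ u ∈ range (m + 1), F (n + i.1 + (j.1 + 1 : ℕ) + u)) * F (e - j.1 : ℕ) := by
      split_ifs with h
      · rfl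
      · have : e - j.1 = 0 := by
          have := mem_range.not.mp h
          omega
        simp [this, hF0]
    rw [hlast, if_pos (mem_range.mpr j.2), prod_range_succ', prod_range_succ]
    have hv := fib_vajda hF0 hF1 hFrec (e - j.1) (m + 1) (n + i.1 + j.1)
    have hj : ((e - j.1 : ℕ) : ℤ) = e - j.1 := Nat.cast_sub (Nat.lt_succ_iff.mp j.2)
    rw [show n + i.1 + j.1 + ((e - j.1 : ℕ) : ℤ) = n + e + i.1 by rw [hj]; ring] at hv
    have h1 : ∀ u : ℕ, n + i.1 + j.1 + ((u + 1 : ℕ) : ℤ) = n + 1 + i.1 + j.1 + u :=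
      fun u => by push_cast; ring
    have h2 : ∀ u : ℤ, n + i.1 + ((j.1 + 1 : ℕ) : ℤ) + u = n + 1 + i.1 + j.1 + u :=
      fun u => by push_cast; ring
    simp only [h1, h2, Nat.cast_zero, add_zero]
    rw [show n + 1 + i.1 + j.1 + (m : ℤ) = n + i.1 + j.1 + (m + 1) by ring]
    linear_combination (-∏ u ∈ range m, F (n + 1 + i.1 + j.1 + u)) * hv
  rw [← hT, ← Matrix.det_mul, hmul, Matrix.det_mul_column, prod_mul_distrib, Fin.prod_const,
    Fin.prod_univ_eq_prod_range (fun i => F (n + e + i)) (e + 1)]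

lemma prod_range_mul_reflect_pow (f : ℕ → R) (e : ℕ) :
    ∏ i ∈ range e, (f i * f (e - 1 - i)) ^ (e - i) = (∏ i ∈ range e, f i) ^ (e + 1) := by
  simp only [mul_pow, prod_mul_distrib]
  rw [← prod_range_reflect (fun i => f (e - 1 - i) ^ (e - i)), ← prod_mul_distrib, ← prod_pow]
  refine prod_congr rfl fun i hi => ?_
  have := mem_range.mp hi
  rw [show e - 1 - (e - 1 - i) = i by omega, ← pow_add]
  congr 1
  omega

lemma even_three_choose_sub (e : ℕ) :
    Even ((e : ℤ) * (e + 1).choose 2 - (e + 2).choose 3) := by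
  have h : ((e + 1 + 1 : ℕ) : ℤ) * (e + 1).choose 2 = (e + 2).choose 3 * 3 := by
    exact_mod_cast Nat.add_one_mul_choose_eq (e + 1) 2
  push_cast at h
  exact ⟨(e + 2).choose 3 - (e + 1).choose 2, by linarith⟩

lemma det_risingPowerMatrix_add [IsDomain R] (hF0 : F 0 = 0) (hF1 : F 1 = 1)
    (hFrec : ∀ n, F (n + 2) = x * F (n + 1) + F n) (hpos : ∀ k : ℤ, 0 < k → F k ≠ 0)
    (n : ℤ) (e r : ℕ) :
    (risingPowerMatrix F n (e + r) (e + 1)).det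
      = (((-1 : Rˣ) ^ (n * (e + 1).choose 2 + (e + 2).choose 3) : Rˣ) : R)
        * (∏ i ∈ range e, (F (i + 1) * F (e + r - i)) ^ (e - i))
        * ∏ i ∈ range (e + 1), ∏ u ∈ range r, F (n + e + i + u) := by
  induction r generalizing n with
  | zero =>
    have h := det_risingPowerMatrix_eq_zpow_mul hF0 hF1 hFrec (1 - e) (n + e - 1) e
    rw [show (1 : ℤ) - e + (n + e - 1) = n by ring, det_risingPowerMatrix_one_sub hF0] at h
    have hsign : (((-1 : Rˣ) ^ ((n + e - 1) * (e + 1).choose 2) : Rˣ) : R)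
        * (-1) ^ (e + 1).choose 2
        = (((-1 : Rˣ) ^ (n * (e + 1).choose 2 + (e + 2).choose 3) : Rˣ) : R) := by
      rw [← units_neg_one_zpow_congr (R := R)
        (a := (n + e - 1) * (e + 1).choose 2 + (e + 1).choose 2)
        (b := n * (e + 1).choose 2 + (e + 2).choose 3), zpow_add, zpow_natCast]
      · simp
      · convert even_three_choose_sub e using 1
        ring
    have hprod : ∏ i ∈ range e, (F (i + 1) * F (e + (0 : ℕ) - i)) ^ (e - i)
        = (∏ u ∈ range e, F (u + 1)) ^ (e + 1) := by
      rw [← prod_range_mul_reflect_pow (fun u : ℕ => F (u + 1))]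
      refine prod_congr rfl fun i hi => ?_
      have := mem_range.mp hi
      rw [show (e : ℤ) + (0 : ℕ) - i = (e - 1 - i : ℕ) + 1 by omega]
    rw [add_zero, h, hprod, ← mul_assoc, hsign]
    simp
  | succ r ih =>
    have h := det_risingPowerMatrix_succ_power hF0 hF1 hFrec n (e + r) e
    rw [ih (n + 1)] at h
    have hne : ∏ j ∈ range (e + 1), ((-1) ^ j * F ((e + r : ℕ) + 1 - j)) ≠ 0 := by
      refine prod_ne_zero_iff.mpr fun j hj => mul_ne_zero (pow_ne_zero _ (by simp)) (hpos _ ?_)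
      have := mem_range.mp hj
      omega
    refine mul_right_cancel₀ hne ?_
    rw [show e + (r + 1) = e + r + 1 by ring, h]
    have hsign : (((-1 : Rˣ) ^ ((n + 1) * (e + 1).choose 2 + (e + 2).choose 3) : Rˣ) : R)
        = (((-1 : Rˣ) ^ (n * (e + 1).choose 2 + (e + 2).choose 3) : Rˣ) : R)
          * ∏ j ∈ range (e + 1), (-1) ^ j := by
      rw [prod_pow_eq_pow_sum, sum_range_id, ← Nat.choose_two_right,
        show (n + 1) * ((e + 1).choose 2 : ℤ) + (e + 2).choose 3
          = n * (e + 1).choose 2 + (e + 2).choose 3 + (e + 1).choose 2 by ring,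
        zpow_add _ _ ((e + 1).choose 2 : ℤ), zpow_natCast]
      simp
    have hwin : ∏ i ∈ range (e + 1), ∏ u ∈ range (r + 1), F (n + e + i + u)
        = (∏ i ∈ range (e + 1), F (n + e + i))
          * ∏ i ∈ range (e + 1), ∏ u ∈ range r, F (n + 1 + e + i + u) := by
      rw [← prod_mul_distrib]
      refine prod_congr rfl fun i _ => ?_
      rw [prod_range_succ', mul_comm]
      congr 1
      · simp
      · exact prod_congr rfl fun u _ => by congr 1; push_cast; ring
    have hcoef : (∏ i ∈ range e, F (e + (r + 1 : ℕ) - i) ^ (e - i))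
          * ∏ j ∈ range (e + 1), F ((e + r : ℕ) + 1 - j)
        = F ((e + r : ℕ) + 1) ^ (e + 1) * ∏ i ∈ range e, F (e + r - i) ^ (e - i) := by
      have h0 : ∏ i ∈ range e, F (e + (r + 1 : ℕ) - i) ^ (e - i)
          = ∏ i ∈ range (e + 1), F (e + (r + 1 : ℕ) - i) ^ (e - i) := by
        simp [prod_range_succ]
      rw [h0, ← prod_mul_distrib, prod_range_succ', mul_comm]
      congr 1
      · push_cast
        rw [Nat.sub_zero, pow_succ]
        congr 2
      · refine prod_congr rfl fun i hi => ?_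
        have := mem_range.mp hi
        rw [show e - i = e - (i + 1) + 1 by omega, pow_succ]
        push_cast
        congr 2 <;> ring_nf
    simp only [mul_pow, prod_mul_distrib] at hcoef ⊢
    rw [hsign, hwin]
    linear_combination (-(((-1 : Rˣ) ^ (n * (e + 1).choose 2 + (e + 2).choose 3) : Rˣ) : R)
      * (∏ j ∈ range (e + 1), (-1) ^ j) * (∏ i ∈ range e, F (i + 1) ^ (e - i))
      * (∏ i ∈ range (e + 1), F (n + e + i))
      * ∏ i ∈ range (e + 1), ∏ u ∈ range r, F (n + 1 + e + i + u)) * hcoef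

end Determinant

lemma fibonacci_polynomial_ne_zero {F : ℤ → Polynomial ℝ} (hF0 : F 0 = 0) (hF1 : F 1 = 1)
    (hFrec : ∀ n : ℤ, F (n + 2) = X * F (n + 1) + F n) {k : ℤ} (hk : 0 < k) : F k ≠ 0 := by
  have key : ∀ k : ℕ, 0 ≤ (F k).eval 1 ∧ 0 < (F (k + 1)).eval 1 := by
    intro k
    induction k with
    | zero => simp [hF0, hF1]
    | succ k ih =>
      push_cast
      refine ⟨ih.2.le, ?_⟩
      rw [show (k : ℤ) + 1 + 1 = k + 2 by ring, hFrec]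
      simp only [eval_add, eval_mul, eval_X, one_mul]
      linarith
  obtain ⟨j, rfl⟩ : ∃ j : ℕ, k = j + 1 := ⟨(k - 1).toNat, by omega⟩
  intro h
  simpa [h] using (key j).2

lemma C_neg_one_zpow (z : ℤ) :
    C ((-1 : ℝ) ^ z) = (((-1 : (Polynomial ℝ)ˣ) ^ z : (Polynomial ℝ)ˣ) : Polynomial ℝ) := by
  rcases Int.even_or_odd z with h | h
  · simp [h.neg_one_zpow]
  · simp [h.neg_one_zpow]

/-- **Corollary 2, fourth identity.** For the Fibonacci polynomials `(F_n(x))_{n∈ℤ}`,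
`m ≥ 1` and `1 ≤ d ≤ m+1`, the determinant of the `d×d` matrix with entries the
rising powers `F_{n+i+j}(x)^{⟨m⟩}` equals
`(−1)^{n·C(d,2)+C(d+1,3)} · ∏_{i=1}^{d−1} (F_i(x) F_{m+1−i}(x))^{d−i}
 · ∏_{i=d−1}^{2(d−1)} F_{n+i}(x)^{⟨m+1−d⟩}`. -/
theorem det_rising_power_matrix_fibonacci_polynomials
    (n : ℤ) (m d : ℕ) (hm : 1 ≤ m) (hd : 1 ≤ d) (hdm : d ≤ m + 1)
    (F : ℤ → Polynomial ℝ)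
    (hF0 : F 0 = 0) (hF1 : F 1 = 1)
    (hFrec : ∀ n : ℤ, F (n + 2) = X * F (n + 1) + F n) :
    Matrix.det (Matrix.of fun i j : Fin d =>
        ∏ u ∈ Finset.range m, F (n + i.1 + j.1 + u))
      = Polynomial.C ((-1 : ℝ)
            ^ (n * (Nat.choose d 2 : ℤ) + (Nat.choose (d + 1) 3 : ℤ)))
        * (∏ i ∈ Finset.Icc 1 (d - 1),
            (F (i : ℤ) * F ((m : ℤ) + 1 - (i : ℤ))) ^ (d - i))
        * ∏ i ∈ Finset.Icc (d - 1) (2 * (d - 1)),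
            ∏ u ∈ Finset.range (m + 1 - d), F (n + i + u) := by
  obtain ⟨e, rfl⟩ : ∃ e, d = e + 1 := ⟨d - 1, by omega⟩
  obtain ⟨r, rfl⟩ : ∃ r, m = e + r := ⟨m - e, by omega⟩
  have h := det_risingPowerMatrix_add hF0 hF1 hFrec
    (fun _ hk => fibonacci_polynomial_ne_zero hF0 hF1 hFrec hk) n e r
  rw [risingPowerMatrix] at h
  rw [h, C_neg_one_zpow, Nat.add_sub_cancel, show e + r + 1 - (e + 1) = r by omega]
  congr 1
  · congr 1
    rw [← Ico_add_one_right_eq_Icc, prod_Ico_eq_prod_range, Nat.add_sub_cancel]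
    refine prod_congr rfl fun i _ => ?_
    rw [show e + 1 - (1 + i) = e - i by omega]
    congr 3 <;> (push_cast; ring)
  · rw [← Ico_add_one_right_eq_Icc, prod_Ico_eq_prod_range,
      show 2 * e + 1 - e = e + 1 by omega]
    refine prod_congr rfl fun i _ => prod_congr rfl fun u _ => ?_
    congr 1
    push_cast
    ring
end
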